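/- arXiv:2007.02212 — 3 statements merged into one kernel-verified Lean document; each statement's English description precedes it below -/
import Mathlib

section
/- Let d ≥ 1 be an integer and α ∈ (0,2) with d > 2−α. Let V be a radial function on ℝ^d (write V(x) = V(|x|)) with V ∈ C¹(ℝ^d) and e^{−V}|∇V| ∈ L¹(ℝ^d; dx) ∩ C_b(ℝ^d), satisfying: limsup_{r→∞} e^{−V(r)} r^{d+α} < ∞; r₀ := sup{r > 0 : V'(r) ≤ 0} < ∞; ∫₀^∞ e^{−V(r)} |V'(r)| r^d dr < ∞; and ∫₀^∞ e^{−V(r)} V'(r) r^d dr > 0. Fix β ∈ (0,α) and let V₀(x) := (1+|x|²)^{β/2}. Then there exist constants C₁, C₂ > 0 such that for all x ∈ ℝ^d: −(−Δ)^{α/2} V₀(x) + ⟨b(x), ∇V₀(x)⟩ ≤ C₁ − C₂ e^{V(|x|)} (1+|x|)^{−(d+α)} V₀(x). -/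
open MeasureTheory Real Filter
open scoped RealInnerProductSpace

/-- The Riesz constant `C_{d,2-α} = Γ((d-(2-α))/2) / (2^{2-α} π^{d/2} Γ((2-α)/2))`. -/
noncomputable def rieszC (d : ℕ) (α : ℝ) : ℝ :=
  Real.Gamma (((d : ℝ) - (2 - α)) / 2) /
    (2 ^ (2 - α) * Real.pi ^ ((d : ℝ) / 2) * Real.Gamma ((2 - α) / 2))

/-- The fractional drift
`b(x) = -C_{d,2-α} e^{V(x)} ∫ e^{-V(y)} ∇V(y) |x-y|^{-(d+α-2)} dy`. -/
noncomputable def fracDrift (d : ℕ) (α : ℝ) (V : EuclideanSpace ℝ (Fin d) → ℝ) :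
    EuclideanSpace ℝ (Fin d) → EuclideanSpace ℝ (Fin d) := fun x =>
  (-(rieszC d α * Real.exp (V x))) •
    ∫ y, (Real.exp (-(V y)) * ‖x - y‖ ^ (-((d : ℝ) + α - 2))) • gradient V y

/-- The constant `c_{d,α} = 2^α Γ((d+α)/2)/(π^{d/2} |Γ(-α/2)|)`. -/
noncomputable def fracCd (d : ℕ) (α : ℝ) : ℝ :=
  2 ^ α * Real.Gamma (((d : ℝ) + α) / 2) /
    (Real.pi ^ ((d : ℝ) / 2) * |Real.Gamma (-α / 2)|)

/-- The `d`-dimensional fractional Laplacian `(-Δ)^{α/2} g`, defined so that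
`-(-Δ)^{α/2} g (x) = c_{d,α} ∫ (g(x+z) - g(x) - ⟨∇g(x), z⟩ 1_{‖z‖≤1}) ‖z‖^{-(d+α)} dz`. -/
noncomputable def fracLapD (d : ℕ) (α : ℝ) (g : EuclideanSpace ℝ (Fin d) → ℝ)
    (x : EuclideanSpace ℝ (Fin d)) : ℝ :=
  -(fracCd d α *
    ∫ z, (g (x + z) - g x - (if ‖z‖ ≤ 1 then ⟪gradient g x, z⟫ else 0)) * ‖z‖ ^ (-((d : ℝ) + α)))


lemma radial_integrable (d : ℕ) (hd : 1 ≤ d) (a b : ℝ) (ha : -(d : ℝ) < a) (hb : b < -(d : ℝ)) :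
    Integrable (fun z : EuclideanSpace ℝ (Fin d) => if ‖z‖ ≤ 1 then ‖z‖ ^ a else ‖z‖ ^ b) := by
  have : Nonempty (Fin d) := ⟨⟨0, hd⟩⟩
  have key := (integrable_fun_norm_addHaar (volume : Measure (EuclideanSpace ℝ (Fin d)))
    (f := fun r : ℝ => if r ≤ 1 then r ^ a else r ^ b)).2
  apply key
  rw [finrank_euclideanSpace_fin, ← Set.Ioc_union_Ioi_eq_Ioi (zero_le_one' ℝ)]
  have hd' : ((d - 1 : ℕ) : ℝ) = d - 1 := by push_cast [hd]; ring
  apply IntegrableOn.union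
  · have h := (intervalIntegrable_iff_integrableOn_Ioc_of_le (zero_le_one' ℝ)).1
      (intervalIntegral.intervalIntegrable_rpow' (a := 0) (b := 1) (r := a + (d - 1)) (by linarith))
    refine h.congr_fun ?_ measurableSet_Ioc
    intro r hr
    simp only [hr.2, if_true, smul_eq_mul]
    rw [Real.rpow_add hr.1, ← hd', Real.rpow_natCast, mul_comm]
  · have h := integrableOn_Ioi_rpow_of_lt (a := b + (d - 1)) (c := 1) (by linarith) one_pos
    refine h.congr_fun ?_ measurableSet_Ioi
    intro r hr
    have hr' : ¬ r ≤ 1 := not_le.2 hr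
    simp only [hr', if_false, smul_eq_mul]
    rw [Real.rpow_add (lt_trans one_pos hr), ← hd', Real.rpow_natCast, mul_comm]

lemma second_diff (d : ℕ) (β : ℝ) (h0 : 0 < β) (h2 : β < 2) (x z : EuclideanSpace ℝ (Fin d)) :
    (1 + ‖x + z‖ ^ 2) ^ (β / 2) + (1 + ‖x - z‖ ^ 2) ^ (β / 2) - 2 * (1 + ‖x‖ ^ 2) ^ (β / 2)
      ≤ 2 * (if ‖z‖ ≤ 1 then ‖z‖ ^ (2 : ℝ) else ‖z‖ ^ β) := by
  have hcc := (Real.concaveOn_rpow (p := β / 2) (by linarith) (by linarith)).2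
  have hc := hcc (show 1 + ‖x + z‖ ^ 2 ∈ Set.Ici (0 : ℝ) from Set.mem_Ici.2 (by positivity))
    (show 1 + ‖x - z‖ ^ 2 ∈ Set.Ici (0 : ℝ) from Set.mem_Ici.2 (by positivity))
    (show (0 : ℝ) ≤ 1 / 2 by norm_num) (show (0 : ℝ) ≤ 1 / 2 by norm_num) (by norm_num)
  have hp : ‖x + z‖ ^ 2 + ‖x - z‖ ^ 2 = 2 * (‖x‖ ^ 2 + ‖z‖ ^ 2) := by
    have := parallelogram_law_with_norm ℝ x z
    nlinarith
  have he : (1 / 2 : ℝ) • (1 + ‖x + z‖ ^ 2) + (1 / 2 : ℝ) • (1 + ‖x - z‖ ^ 2)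
      = (1 + ‖x‖ ^ 2) + ‖z‖ ^ 2 := by
    simp only [smul_eq_mul]; linarith
  rw [he] at hc
  simp only [smul_eq_mul] at hc
  set A := 1 + ‖x‖ ^ 2 with hA
  have hA1 : 1 ≤ A := by rw [hA]; nlinarith [sq_nonneg ‖x‖]
  have hA0 : 0 < A := by linarith
  have hmain : (A + ‖z‖ ^ 2) ^ (β / 2) - A ^ (β / 2) ≤
      (if ‖z‖ ≤ 1 then ‖z‖ ^ (2 : ℝ) else ‖z‖ ^ β) := by
    split_ifs with h
    · have h1 : (A + ‖z‖ ^ 2) = A * (1 + ‖z‖ ^ 2 / A) := by field_simp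
      rw [h1, Real.mul_rpow hA0.le (by positivity)]
      have h2' := rpow_one_add_le_one_add_mul_self (s := ‖z‖ ^ 2 / A)
        (by have : 0 ≤ ‖z‖ ^ 2 / A := by positivity
            linarith) (p := β / 2) (by linarith) (by linarith)
      have h3 : A ^ (β / 2) ≤ A := by
        conv_rhs => rw [← Real.rpow_one A]
        exact Real.rpow_le_rpow_of_exponent_le hA1 (by linarith)
      have h4 : A ^ (β / 2) * (β / 2 * (‖z‖ ^ 2 / A)) ≤ ‖z‖ ^ 2 := by
        calc A ^ (β / 2) * (β / 2 * (‖z‖ ^ 2 / A)) ≤ A * (1 * (‖z‖ ^ 2 / A)) := by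
              gcongr; linarith
          _ = ‖z‖ ^ 2 := by field_simp
      have h5 : 0 ≤ A ^ (β / 2) := by positivity
      rw [Real.rpow_two]
      nlinarith [mul_le_mul_of_nonneg_left h2' h5]
    · have := Real.rpow_add_le_add_rpow (p := β / 2) hA0.le (sq_nonneg ‖z‖) (by linarith) (by linarith)
      have e : (‖z‖ ^ 2) ^ (β / 2) = ‖z‖ ^ β := by
        rw [← Real.rpow_natCast, ← Real.rpow_mul (norm_nonneg _)]; congr 1; push_cast; ring
      rw [e] at this; linarith
  linarith

lemma fracLap_bound (d : ℕ) (hd : 1 ≤ d) (α : ℝ) (hα : α ∈ Set.Ioo (0 : ℝ) 2)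
    (β : ℝ) (hβ : β ∈ Set.Ioo 0 α) :
    ∃ L : ℝ, 0 < L ∧ ∀ x : EuclideanSpace ℝ (Fin d),
      -fracLapD d α (fun y => (1 + ‖y‖ ^ 2) ^ (β / 2)) x ≤ L := by
  obtain ⟨hα0, hα2⟩ := hα
  obtain ⟨hβ0, hβα⟩ := hβ
  set m : EuclideanSpace ℝ (Fin d) → ℝ := fun z =>
    if ‖z‖ ≤ 1 then ‖z‖ ^ (2 - (d + α)) else ‖z‖ ^ (β - (d + α)) with hm
  have hmi : Integrable m := radial_integrable d hd _ _ (by linarith) (by linarith)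
  have hm0 : ∀ z, 0 ≤ m z := by
    intro z; simp only [hm]; split_ifs <;> positivity
  have hc : 0 ≤ fracCd d α := by
    unfold fracCd
    have : 0 < Real.Gamma (((d : ℝ) + α) / 2) := Real.Gamma_pos_of_pos (by positivity)
    positivity
  have hI : 0 ≤ ∫ z, m z := integral_nonneg hm0
  refine ⟨fracCd d α * (∫ z, m z) + 1, by positivity, fun x => ?_⟩
  unfold fracLapD
  rw [neg_neg]
  suffices h : (∫ z : EuclideanSpace ℝ (Fin d), ((1 + ‖x + z‖ ^ 2) ^ (β / 2) - (1 + ‖x‖ ^ 2) ^ (β / 2) -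
      (if ‖z‖ ≤ 1 then ⟪gradient (fun y : EuclideanSpace ℝ (Fin d) => (1 + ‖y‖ ^ 2) ^ (β / 2)) x, z⟫ else 0)) *
        ‖z‖ ^ (-((d : ℝ) + α))) ≤ ∫ z, m z by
    have := mul_le_mul_of_nonneg_left h hc
    linarith
  set G := gradient (fun y : EuclideanSpace ℝ (Fin d) => (1 + ‖y‖ ^ 2) ^ (β / 2)) x
  set h : EuclideanSpace ℝ (Fin d) → ℝ := fun z => ((1 + ‖x + z‖ ^ 2) ^ (β / 2) - (1 + ‖x‖ ^ 2) ^ (β / 2) -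
      (if ‖z‖ ≤ 1 then ⟪G, z⟫ else 0)) * ‖z‖ ^ (-((d : ℝ) + α)) with hh
  by_cases hint : Integrable h
  · have e1 : ∫ z, h (-z) = ∫ z, h z := integral_neg_eq_self h volume
    have e2 : ∫ z, (h z + h (-z)) = (∫ z, h z) + ∫ z, h (-z) := integral_add hint hint.comp_neg
    have e3 : ∫ z, (h z + h (-z)) ≤ ∫ z, 2 * m z := by
      refine integral_mono (hint.add hint.comp_neg) (hmi.const_mul 2) ?_
      intro z
      by_cases hz : z = 0
      · subst hz; simp [hh, hm]
        positivity
      have hz' : 0 < ‖z‖ := norm_pos_iff.2 hz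
      have e : h z + h (-z) = ((1 + ‖x + z‖ ^ 2) ^ (β / 2) + (1 + ‖x - z‖ ^ 2) ^ (β / 2)
          - 2 * (1 + ‖x‖ ^ 2) ^ (β / 2)) * ‖z‖ ^ (-((d : ℝ) + α)) := by
        simp only [hh, norm_neg, inner_neg_right, ← sub_eq_add_neg]
        split_ifs <;> ring
      have em : 2 * m z = 2 * (if ‖z‖ ≤ 1 then ‖z‖ ^ (2 : ℝ) else ‖z‖ ^ β) * ‖z‖ ^ (-((d : ℝ) + α)) := by
        simp only [hm, sub_eq_add_neg (2 : ℝ), sub_eq_add_neg β, Real.rpow_add hz']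
        split_ifs <;> ring
      show h z + h (-z) ≤ 2 * m z
      rw [e, em]
      exact mul_le_mul_of_nonneg_right (second_diff d β hβ0 (by linarith) x z) (by positivity)
    rw [integral_const_mul] at e3
    linarith
  · rw [integral_undef hint]; exact hI

lemma gradient_V0 (d : ℕ) (β : ℝ) (x : EuclideanSpace ℝ (Fin d)) :
    gradient (fun y : EuclideanSpace ℝ (Fin d) => (1 + ‖y‖ ^ 2) ^ (β / 2)) x =
      (β * (1 + ‖x‖ ^ 2) ^ (β / 2 - 1)) • x := by
  apply HasGradientAt.gradient
  rw [hasGradientAt_iff_hasFDerivAt]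
  have h1 := ((hasStrictFDerivAt_norm_sq x).hasFDerivAt.const_add 1).rpow_const (p := β / 2)
    (Or.inl (by positivity))
  refine h1.congr_fderiv ?_
  ext z
  simp
  ring

lemma gradient_V (d : ℕ) (V : EuclideanSpace ℝ (Fin d) → ℝ) (v : ℝ → ℝ)
    (hrad : ∀ x, V x = v ‖x‖) (hV : ContDiff ℝ 1 V) (y : EuclideanSpace ℝ (Fin d)) (hy : y ≠ 0) :
    gradient V y = (deriv v ‖y‖ / ‖y‖) • y := by
  have hy' : 0 < ‖y‖ := norm_pos_iff.2 hy
  have hv : DifferentiableAt ℝ v ‖y‖ := by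
    have h1 : DifferentiableAt ℝ (fun r : ℝ => V ((r / ‖y‖) • y)) ‖y‖ :=
      ((hV.differentiable one_ne_zero).comp (by fun_prop)).differentiableAt
    refine h1.congr_of_eventuallyEq ?_
    filter_upwards [lt_mem_nhds hy'] with r hr
    rw [hrad, norm_smul, norm_div, norm_norm, Real.norm_of_nonneg hr.le]
    congr 1; field_simp
  apply HasGradientAt.gradient
  rw [hasGradientAt_iff_hasFDerivAt]
  have hs : HasFDerivAt (fun z : EuclideanSpace ℝ (Fin d) => √(‖z‖ ^ 2)) _ y :=
    (hasStrictFDerivAt_norm_sq y).hasFDerivAt.sqrt (by positivity)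
  have hs' := hs
  simp only [Real.sqrt_sq (norm_nonneg _)] at hs'
  have h2 := hv.hasDerivAt.comp_hasFDerivAt y hs'
  have h3 : V = v ∘ fun z => ‖z‖ := by ext z; exact hrad z
  rw [h3]
  refine h2.congr_fderiv ?_
  ext z
  simp
  field_simp

lemma riesz_int (d : ℕ) (hd : 1 ≤ d) (γ : ℝ) (hγ : 0 < γ) (hγd : γ < d)
    (V : EuclideanSpace ℝ (Fin d) → ℝ) (hV : ContDiff ℝ 1 V)
    (hL1 : Integrable (fun y => Real.exp (-(V y)) * ‖gradient V y‖))
    (M : ℝ) (hM : ∀ y, Real.exp (-(V y)) * ‖gradient V y‖ ≤ M) :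
    ∃ N : ℝ, 0 ≤ N ∧ ∀ x : EuclideanSpace ℝ (Fin d),
      Integrable (fun y => (Real.exp (-(V y)) * ‖x - y‖ ^ (-γ)) • gradient V y) ∧
      ‖∫ y, (Real.exp (-(V y)) * ‖x - y‖ ^ (-γ)) • gradient V y‖ ≤ N := by
  set m : EuclideanSpace ℝ (Fin d) → ℝ := fun z =>
    if ‖z‖ ≤ 1 then ‖z‖ ^ (-γ) else ‖z‖ ^ (-(d : ℝ) - 1) with hm
  have hmi : Integrable m := radial_integrable d hd _ _ (by linarith) (by linarith)
  have hm0 : ∀ z, 0 ≤ m z := by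
    intro z; simp only [hm]; split_ifs <;> positivity
  have hM0 : 0 ≤ M := le_trans (by positivity) (hM 0)
  have hI0 : 0 ≤ ∫ z, m z := integral_nonneg hm0
  have hW0 : 0 ≤ ∫ y, Real.exp (-(V y)) * ‖gradient V y‖ :=
    integral_nonneg (fun y => by positivity)
  have hgc : Continuous (gradient V) := by
    unfold gradient
    exact (LinearIsometryEquiv.continuous _).comp (hV.continuous_fderiv one_ne_zero)
  have hVc := hV.continuous
  refine ⟨M * (∫ z, m z) + ∫ y, Real.exp (-(V y)) * ‖gradient V y‖, by positivity, fun x => ?_⟩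
  have hb : Integrable (fun y => M * m (x - y) + Real.exp (-(V y)) * ‖gradient V y‖) :=
    ((hmi.comp_sub_left x).const_mul M).add hL1
  have hle : ∀ y, ‖(Real.exp (-(V y)) * ‖x - y‖ ^ (-γ)) • gradient V y‖ ≤
      M * m (x - y) + Real.exp (-(V y)) * ‖gradient V y‖ := by
    intro y
    rw [norm_smul, Real.norm_of_nonneg (by positivity)]
    have h0 : 0 ≤ Real.exp (-(V y)) * ‖gradient V y‖ := by positivity
    have h1 := hM y
    by_cases h : ‖x - y‖ ≤ 1
    · have hp : 0 ≤ ‖x - y‖ ^ (-γ) := by positivity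
      simp only [hm, h, if_true]
      nlinarith [mul_le_mul_of_nonneg_right h1 hp]
    · have hp : ‖x - y‖ ^ (-γ) ≤ 1 :=
        Real.rpow_le_one_of_one_le_of_nonpos (by linarith) (by linarith)
      have := mul_nonneg hM0 (hm0 (x - y))
      nlinarith [mul_le_mul_of_nonneg_left hp h0]
  have hmeas : AEStronglyMeasurable
      (fun y => (Real.exp (-(V y)) * ‖x - y‖ ^ (-γ)) • gradient V y) volume := by
    have h1 : Measurable (fun y => Real.exp (-(V y)) * ‖x - y‖ ^ (-γ)) := by
      have : Measurable (fun y => Real.exp (-(V y))) := by fun_prop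
      have h2 : Measurable (fun y : EuclideanSpace ℝ (Fin d) => ‖x - y‖ ^ (-γ)) :=
        (measurable_const.sub measurable_id).norm.pow_const _
      exact this.mul h2
    exact (h1.smul hgc.measurable).aestronglyMeasurable
  refine ⟨hb.mono' hmeas (Filter.Eventually.of_forall hle), ?_⟩
  refine (norm_integral_le_of_norm_le hb (Filter.Eventually.of_forall hle)).trans ?_
  rw [integral_add ((hmi.comp_sub_left x).const_mul M) hL1, integral_const_mul,
    integral_sub_left_eq_self m volume x]

lemma rot_int (d : ℕ) (ρ : ℝ → ℝ)
    (hi : Integrable (fun y : EuclideanSpace ℝ (Fin d) => ρ ‖y‖ * ‖y‖ ^ 2))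
    (e : EuclideanSpace ℝ (Fin d)) (he : ‖e‖ = 1) :
    Integrable (fun y : EuclideanSpace ℝ (Fin d) => ρ ‖y‖ * ⟪e, y⟫ ^ 2) := by
  have h : (fun y : EuclideanSpace ℝ (Fin d) => ρ ‖y‖ * ⟪e, y⟫ ^ 2) =
      fun y => (⟪e, y⟫ ^ 2 / ‖y‖ ^ 2) * (ρ ‖y‖ * ‖y‖ ^ 2) := by
    ext y
    by_cases hy : y = 0
    · simp [hy]
    · have : ‖y‖ ≠ 0 := norm_ne_zero_iff.2 hy
      field_simp
  rw [h]
  refine hi.bdd_mul (c := 1) ?_ ?_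
  · have h1 : Measurable (fun y : EuclideanSpace ℝ (Fin d) => ⟪e, y⟫ ^ 2) := by fun_prop
    have h2 : Measurable (fun y : EuclideanSpace ℝ (Fin d) => ‖y‖ ^ 2) := by fun_prop
    exact (h1.div h2).aestronglyMeasurable
  · refine Filter.Eventually.of_forall fun y => ?_
    rw [Real.norm_of_nonneg (by positivity)]
    apply div_le_one_of_le₀ _ (by positivity)
    rw [sq_le_sq, abs_norm]
    have := abs_real_inner_le_norm e y
    rwa [he, one_mul] at this

lemma rot_eq (d : ℕ) (ρ : ℝ → ℝ)
    (hi : Integrable (fun y : EuclideanSpace ℝ (Fin d) => ρ ‖y‖ * ‖y‖ ^ 2))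
    (e : EuclideanSpace ℝ (Fin d)) (he : ‖e‖ = 1) :
    (d : ℝ) * ∫ y : EuclideanSpace ℝ (Fin d), ρ ‖y‖ * ⟪e, y⟫ ^ 2 =
      ∫ y : EuclideanSpace ℝ (Fin d), ρ ‖y‖ * ‖y‖ ^ 2 := by
  have h1 : ∀ f : EuclideanSpace ℝ (Fin d), ‖f‖ = 1 →
      ∫ y : EuclideanSpace ℝ (Fin d), ρ ‖y‖ * ⟪f, y⟫ ^ 2 =
      ∫ y : EuclideanSpace ℝ (Fin d), ρ ‖y‖ * ⟪e, y⟫ ^ 2 := by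
    intro f hf
    set T := (Submodule.span ℝ {e - f})ᗮ.reflection
    have hT : T e = f := Submodule.reflection_sub (by rw [he, hf])
    have := T.measurePreserving.integral_comp T.toHomeomorph.measurableEmbedding
      (fun y => ρ ‖y‖ * ⟪f, y⟫ ^ 2)
    rw [← this]
    congr 1; ext y
    rw [← hT, LinearIsometryEquiv.inner_map_map, LinearIsometryEquiv.norm_map]
  have h2 : (fun y : EuclideanSpace ℝ (Fin d) => ρ ‖y‖ * ‖y‖ ^ 2) =
      fun y => ∑ i : Fin d, ρ ‖y‖ * ⟪EuclideanSpace.single i (1 : ℝ), y⟫ ^ 2 := by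
    ext y
    rw [← Finset.mul_sum, EuclideanSpace.norm_sq_eq]
    simp [EuclideanSpace.inner_single_left]
  rw [h2, integral_finsetSum]
  · rw [Finset.sum_congr rfl (fun i _ => h1 _ (by simp))]
    simp
  · intro i _
    exact rot_int d ρ hi _ (by simp)

lemma mvt_rpow (p a b : ℝ) (ha : 0 < a) (hb : 0 < b) (hab : a ≠ b) :
    ∃ c, min a b ≤ c ∧ c ≤ max a b ∧ a ^ p - b ^ p = p * c ^ (p - 1) * (a - b) := by
  wlog h : a < b generalizing a b
  · obtain ⟨c, h1, h2, h3⟩ := this b a hb ha hab.symm (lt_of_le_of_ne (not_lt.1 h) hab.symm)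
    exact ⟨c, by rwa [min_comm], by rwa [max_comm], by linarith⟩
  obtain ⟨c, hc, hc'⟩ := exists_hasDerivAt_eq_slope (fun x : ℝ => x ^ p)
    (fun x => p * x ^ (p - 1)) h
    (fun x hx => (Real.continuousAt_rpow_const x p
      (Or.inl (by have := hx.1; linarith))).continuousWithinAt)
    (fun x hx => Real.hasDerivAt_rpow_const (Or.inl (by have := hx.1; linarith)))
  refine ⟨c, (min_le_left _ _).trans hc.1.le, hc.2.le.trans (le_max_right _ _), ?_⟩
  rw [hc']
  have : b - a ≠ 0 := by linarith
  field_simp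
  ring

lemma norm_rpow_sq {E : Type*} [NormedAddCommGroup E] (x : E) (γ : ℝ) :
    ‖x‖ ^ (-γ) = (‖x‖ ^ 2) ^ (-γ / 2) := by
  rw [← Real.rpow_natCast, ← Real.rpow_mul (norm_nonneg _)]; congr 1; push_cast; ring

lemma kernel_est (d : ℕ) (γ : ℝ) (R : ℝ) (hR : 0 < R) (ε : ℝ) (hε : 0 < ε) :
    ∃ X : ℝ, 1 ≤ X ∧ ∀ x y : EuclideanSpace ℝ (Fin d), X ≤ ‖x‖ → ‖y‖ ≤ R →
      ∃ κ : ℝ, |κ - 1| ≤ ε ∧ ⟪y, x⟫ * (‖x - y‖ ^ (-γ) - ‖x + y‖ ^ (-γ)) =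
        κ * (2 * γ * ‖x‖ ^ (-γ) * (⟪y, x⟫ ^ 2 / ‖x‖ ^ 2)) := by
  have hcont : ContinuousAt (fun u : ℝ => u ^ (-γ / 2 - 1)) 1 :=
    Real.continuousAt_rpow_const 1 _ (Or.inl one_ne_zero)
  obtain ⟨δ₀, hδ₀, hδ'⟩ := Metric.continuousAt_iff.1 hcont ε hε
  set δ := min δ₀ (1 / 2) with hδdef
  have hδ : 0 < δ := lt_min hδ₀ (by norm_num)
  have hδ1 : δ ≤ 1 / 2 := min_le_right _ _
  refine ⟨(R ^ 2 + 2 * R) / δ + 1, by have : 0 < (R ^ 2 + 2 * R) / δ := by positivity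
                                      linarith, ?_⟩
  intro x y hx hy
  have hx1 : 1 ≤ ‖x‖ := le_trans (by have : 0 < (R ^ 2 + 2 * R) / δ := by positivity
                                     linarith) hx
  set s := ⟪y, x⟫ with hs
  by_cases hs0 : s = 0
  · exact ⟨1, by simpa using hε.le, by simp [hs0]⟩
  have ea : ‖x - y‖ ^ 2 = ‖x‖ ^ 2 + ‖y‖ ^ 2 - 2 * s := by
    rw [norm_sub_sq_real, real_inner_comm]; ring
  have eb : ‖x + y‖ ^ 2 = ‖x‖ ^ 2 + ‖y‖ ^ 2 + 2 * s := by
    rw [norm_add_sq_real, real_inner_comm]; ring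
  have hsle : |s| ≤ ‖x‖ * R := by
    have := abs_real_inner_le_norm y x
    nlinarith [norm_nonneg x]
  have hs1 := abs_le.1 hsle
  have hy2 : ‖y‖ ^ 2 ≤ R ^ 2 := by gcongr
  have hy0 : 0 ≤ ‖y‖ ^ 2 := by positivity
  have hbig : R ^ 2 + 2 * (‖x‖ * R) < δ * ‖x‖ ^ 2 := by
    have h1 : (R ^ 2 + 2 * R) / δ < ‖x‖ := by linarith
    rw [div_lt_iff₀ hδ] at h1
    have h2 : (R ^ 2 + 2 * R) * ‖x‖ < (‖x‖ * δ) * ‖x‖ := by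
      apply mul_lt_mul_of_pos_right h1; linarith
    nlinarith [mul_le_mul_of_nonneg_left hx1 (sq_nonneg R)]
  have hT : 0 < ‖x‖ ^ 2 := by positivity
  have hT2 : δ * ‖x‖ ^ 2 ≤ ‖x‖ ^ 2 / 2 := by nlinarith
  obtain ⟨c, hc1, hc2, hc⟩ := mvt_rpow (-γ / 2) (‖x - y‖ ^ 2) (‖x + y‖ ^ 2)
    (by rw [ea]; linarith) (by rw [eb]; linarith)
    (by rw [ea, eb]; intro h; apply hs0; linarith)
  have hc1' : ‖x‖ ^ 2 - δ * ‖x‖ ^ 2 < c := lt_of_lt_of_le (by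
    rw [ea, eb]; apply lt_min <;> linarith) hc1
  have hc2' : c < ‖x‖ ^ 2 + δ * ‖x‖ ^ 2 := lt_of_le_of_lt hc2 (by
    rw [ea, eb]; apply max_lt <;> linarith)
  have hc0 : 0 < c := by linarith
  refine ⟨(c / ‖x‖ ^ 2) ^ (-γ / 2 - 1), ?_, ?_⟩
  · have h1 : dist (c / ‖x‖ ^ 2) 1 < δ₀ := by
      rw [Real.dist_eq]
      refine lt_of_lt_of_le ?_ (min_le_left δ₀ (1 / 2))
      rw [← hδdef]
      have : c / ‖x‖ ^ 2 - 1 = (c - ‖x‖ ^ 2) / ‖x‖ ^ 2 := by field_simp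
      rw [this, abs_div, abs_of_pos hT, div_lt_iff₀ hT, abs_lt]
      constructor <;> linarith
    have h2 := hδ' h1
    rw [Real.dist_eq, Real.one_rpow] at h2
    exact h2.le
  · rw [norm_rpow_sq, norm_rpow_sq (x + y), hc, norm_rpow_sq x, ea, eb,
      Real.div_rpow hc0.le hT.le, Real.rpow_sub_one hT.ne']
    have : (‖x‖ ^ 2) ^ (-γ / 2) ≠ 0 := (Real.rpow_pos_of_pos hT _).ne'
    field_simp
    ring

lemma kernel_nonneg (d : ℕ) (γ : ℝ) (hγ : 0 < γ) (x y : EuclideanSpace ℝ (Fin d))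
    (h1 : x - y ≠ 0) (h2 : x + y ≠ 0) :
    0 ≤ ⟪y, x⟫ * (‖x - y‖ ^ (-γ) - ‖x + y‖ ^ (-γ)) := by
  have ea : ‖x - y‖ ^ 2 = ‖x‖ ^ 2 + ‖y‖ ^ 2 - 2 * ⟪y, x⟫ := by
    rw [norm_sub_sq_real, real_inner_comm]; ring
  have eb : ‖x + y‖ ^ 2 = ‖x‖ ^ 2 + ‖y‖ ^ 2 + 2 * ⟪y, x⟫ := by
    rw [norm_add_sq_real, real_inner_comm]; ring
  have p1 := norm_pos_iff.2 h1
  have p2 := norm_pos_iff.2 h2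
  rcases le_total 0 ⟪y, x⟫ with h | h
  · apply mul_nonneg h
    have : ‖x - y‖ ≤ ‖x + y‖ := by
      apply le_of_sq_le_sq _ p2.le; linarith
    have := Real.rpow_le_rpow_of_nonpos p1 this (z := -γ) (by linarith)
    linarith
  · apply mul_nonneg_of_nonpos_of_nonpos h
    have : ‖x + y‖ ≤ ‖x - y‖ := by
      apply le_of_sq_le_sq _ p1.le; linarith
    have := Real.rpow_le_rpow_of_nonpos p2 this (z := -γ) (by linarith)
    linarith

lemma drift_lower (d : ℕ) (hd : 1 ≤ d) (γ : ℝ) (hγ : 0 < γ)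
    (V : EuclideanSpace ℝ (Fin d) → ℝ) (v : ℝ → ℝ)
    (hrad : ∀ x, V x = v ‖x‖) (hV : ContDiff ℝ 1 V)
    (hQ : ∀ x : EuclideanSpace ℝ (Fin d),
      Integrable (fun y => (Real.exp (-(V y)) * ‖x - y‖ ^ (-γ)) • gradient V y))
    (hr0 : BddAbove {r : ℝ | 0 < r ∧ deriv v r ≤ 0})
    (hint : IntegrableOn (fun r => Real.exp (-(v r)) * |deriv v r| * r ^ d) (Set.Ioi 0))
    (hpos : 0 < ∫ r in Set.Ioi (0 : ℝ), Real.exp (-(v r)) * deriv v r * r ^ d) :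
    ∃ X c : ℝ, 1 ≤ X ∧ 0 < c ∧ ∀ x : EuclideanSpace ℝ (Fin d), X ≤ ‖x‖ →
      c * ‖x‖ ^ (-γ) ≤ ⟪∫ y, (Real.exp (-(V y)) * ‖x - y‖ ^ (-γ)) • gradient V y, x⟫ := by
  have hne : Nonempty (Fin d) := ⟨⟨0, hd⟩⟩
  have hd0 : (0 : ℝ) < d := by exact_mod_cast hd
  set g : ℝ → ℝ := fun r => Real.exp (-(v r)) * deriv v r with hg
  have hgi : IntegrableOn (fun r => g r * r ^ d) (Set.Ioi 0) := by
    by_contra h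
    rw [integral_undef h] at hpos
    exact lt_irrefl _ hpos
  have hgabs : ∀ r, |g r| = Real.exp (-(v r)) * |deriv v r| := fun r => by
    simp only [hg, abs_mul, Real.abs_exp]
  have hgai : IntegrableOn (fun r => |g r| * r ^ d) (Set.Ioi 0) := by
    simp only [hgabs]; exact hint
  obtain ⟨r0, hr0⟩ := hr0
  have hgpos : ∀ r, 0 < r → r0 < r → 0 < g r := by
    intro r h1 h2
    have : 0 < deriv v r := by
      by_contra h
      exact absurd (hr0 ⟨h1, not_lt.1 h⟩) (not_le.2 h2)
    simp only [hg]; positivity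
  -- choice of the radius
  obtain ⟨R, hA, hR0, hRr0⟩ : ∃ R, 0 < (∫ r in (0 : ℝ)..R, g r * r ^ d) ∧ 0 < R ∧ r0 < R := by
    have ht := intervalIntegral_tendsto_integral_Ioi (0 : ℝ) hgi Filter.tendsto_id
    have h1 := ht.eventually (lt_mem_nhds hpos)
    exact (h1.and ((Filter.eventually_gt_atTop 0).and (Filter.eventually_gt_atTop r0))).exists
  rw [intervalIntegral.integral_of_le hR0.le] at hA
  set A := ∫ r in Set.Ioc 0 R, g r * r ^ d with hAdef
  set B := ∫ r in Set.Ioc 0 R, |g r| * r ^ d with hBdef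
  have hB : 0 ≤ B := setIntegral_nonneg measurableSet_Ioc fun r hr => by
    have := hr.1; positivity
  have hgR : IntegrableOn (fun r => g r * r ^ d) (Set.Ioc 0 R) := hgi.mono_set Set.Ioc_subset_Ioi_self
  have hgaR : IntegrableOn (fun r => |g r| * r ^ d) (Set.Ioc 0 R) :=
    hgai.mono_set Set.Ioc_subset_Ioi_self
  set ε := A / (2 * (B + 1)) with hεdef
  have hε : 0 < ε := by positivity
  have hεB : ε * B ≤ A / 2 := by
    rw [hεdef, div_mul_eq_mul_div, div_le_iff₀ (by positivity)]
    nlinarith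
  set ρ : ℝ → ℝ := fun r => if r ≤ R then (g r - ε * |g r|) / r else 0 with hρ
  have hform : ∀ r ∈ Set.Ioi (0 : ℝ), (Set.Ioc 0 R).indicator
      (fun r => g r * r ^ d - ε * (|g r| * r ^ d)) r = r ^ (d - 1) • (ρ r * r ^ 2) := by
    intro r hr
    have hr' : (0 : ℝ) < r := hr
    obtain ⟨n, rfl⟩ : ∃ n, d = n + 1 := ⟨d - 1, by omega⟩
    by_cases h : r ≤ R
    · rw [Set.indicator_of_mem (Set.mem_Ioc.2 ⟨hr', h⟩)]
      simp only [hρ, h, if_true, smul_eq_mul, Nat.add_sub_cancel]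
      field_simp
      ring
    · rw [Set.indicator_of_notMem (fun h' => h h'.2)]
      simp [hρ, h]
  have hbase : IntegrableOn (fun r => g r * r ^ d - ε * (|g r| * r ^ d)) (Set.Ioc 0 R) :=
    hgR.sub (hgaR.const_mul ε)
  have hρi : Integrable (fun y : EuclideanSpace ℝ (Fin d) => ρ ‖y‖ * ‖y‖ ^ 2) := by
    apply (integrable_fun_norm_addHaar (volume : Measure (EuclideanSpace ℝ (Fin d)))
      (f := fun r : ℝ => ρ r * r ^ 2)).2
    rw [finrank_euclideanSpace_fin]
    have h1 := ((integrable_indicator_iff measurableSet_Ioc).2 hbase).integrableOn (s := Set.Ioi 0)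
    exact h1.congr_fun hform measurableSet_Ioi
  have hS : 0 < ∫ y : EuclideanSpace ℝ (Fin d), ρ ‖y‖ * ‖y‖ ^ 2 := by
    rw [integral_fun_norm_addHaar (volume : Measure (EuclideanSpace ℝ (Fin d)))
      (fun r : ℝ => ρ r * r ^ 2), finrank_euclideanSpace_fin,
      ← setIntegral_congr_fun measurableSet_Ioi hform,
      setIntegral_indicator measurableSet_Ioc,
      Set.inter_eq_self_of_subset_right Set.Ioc_subset_Ioi_self,
      integral_sub hgR (hgaR.const_mul ε), integral_const_mul, nsmul_eq_mul, smul_eq_mul]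
    have hvol : 0 < (volume : Measure (EuclideanSpace ℝ (Fin d))).real (Metric.ball 0 1) :=
      ENNReal.toReal_pos (Metric.measure_ball_pos _ _ one_pos).ne' measure_ball_lt_top.ne
    have : 0 < A - ε * B := by linarith
    positivity
  set S := ∫ y : EuclideanSpace ℝ (Fin d), ρ ‖y‖ * ‖y‖ ^ 2 with hSdef
  obtain ⟨X, hX1, hX⟩ := kernel_est d γ R hR0 ε hε
  refine ⟨X, γ * (S / d), hX1, by positivity, fun x hx => ?_⟩
  have hx0 : 0 < ‖x‖ := by linarith
  set h : EuclideanSpace ℝ (Fin d) → ℝ := fun y => g ‖y‖ / ‖y‖ * ⟪y, x⟫ * ‖x - y‖ ^ (-γ) with hh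
  have hae : (fun y => ⟪x, (Real.exp (-(V y)) * ‖x - y‖ ^ (-γ)) • gradient V y⟫) =ᵐ[volume] h := by
    filter_upwards [Measure.ae_ne volume (0 : EuclideanSpace ℝ (Fin d))] with y hy
    rw [gradient_V d V v hrad hV y hy, inner_smul_right, inner_smul_right, real_inner_comm,
      hrad y]
    simp only [hh, hg]
    ring
  have hhi : Integrable h := ((hQ x).const_inner x).congr hae
  have e0 : ⟪∫ y, (Real.exp (-(V y)) * ‖x - y‖ ^ (-γ)) • gradient V y, x⟫ = ∫ y, h y := by
    rw [real_inner_comm, ← integral_inner (hQ x), integral_congr_ae hae]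
  have e1 : ∫ z, h (-z) = ∫ z, h z := integral_neg_eq_self h volume
  have e2 : ∫ z, (h z + h (-z)) = (∫ z, h z) + ∫ z, h (-z) := integral_add hhi hhi.comp_neg
  set e : EuclideanSpace ℝ (Fin d) := ‖x‖⁻¹ • x with hedef
  have he : ‖e‖ = 1 := by rw [hedef, norm_smul, norm_inv, norm_norm]; field_simp
  have hk := rot_int d ρ hρi e he
  have hkeq := rot_eq d ρ hρi e he
  have e3 : ∫ y, (2 * γ * ‖x‖ ^ (-γ)) * (ρ ‖y‖ * ⟪e, y⟫ ^ 2) ≤ ∫ z, (h z + h (-z)) := by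
    refine integral_mono_ae (hk.const_mul _) (hhi.add hhi.comp_neg) ?_
    filter_upwards [Measure.ae_ne volume (0 : EuclideanSpace ℝ (Fin d)),
      Measure.ae_ne volume x, Measure.ae_ne volume (-x)] with y hy0 hyx hynx
    have hy' : 0 < ‖y‖ := norm_pos_iff.2 hy0
    have es : h y + h (-y) = g ‖y‖ / ‖y‖ *
        (⟪y, x⟫ * (‖x - y‖ ^ (-γ) - ‖x + y‖ ^ (-γ))) := by
      simp only [hh, norm_neg, inner_neg_left, sub_neg_eq_add]; ring
    rw [es]
    by_cases hyR : ‖y‖ ≤ R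
    · obtain ⟨κ, hκ, hκe⟩ := hX x y hx hyR
      rw [hκe]
      have ee : ⟪e, y⟫ ^ 2 = ⟪y, x⟫ ^ 2 / ‖x‖ ^ 2 := by
        rw [hedef, real_inner_smul_left, real_inner_comm]; field_simp
      rw [ee]
      simp only [hρ, hyR, if_true]
      have hp : 0 ≤ 2 * γ * ‖x‖ ^ (-γ) * (⟪y, x⟫ ^ 2 / ‖x‖ ^ 2) / ‖y‖ := by positivity
      have hgk : g ‖y‖ - ε * |g ‖y‖| ≤ g ‖y‖ * κ := by
        have h1 : |g ‖y‖ * (κ - 1)| ≤ |g ‖y‖| * ε := by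
          rw [abs_mul]; exact mul_le_mul_of_nonneg_left hκ (abs_nonneg _)
        have := (abs_le.1 h1).1
        linarith
      have := mul_le_mul_of_nonneg_right hgk hp
      calc _ = (g ‖y‖ - ε * |g ‖y‖|) * (2 * γ * ‖x‖ ^ (-γ) * (⟪y, x⟫ ^ 2 / ‖x‖ ^ 2) / ‖y‖) := by ring
        _ ≤ _ := this
        _ = _ := by ring
    · have hgp : 0 < g ‖y‖ := hgpos _ hy' (by linarith)
      have := kernel_nonneg d γ hγ x y (sub_ne_zero.2 hyx.symm)
        (fun hc => hynx (by rw [eq_neg_iff_add_eq_zero, add_comm]; exact hc))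
      simp only [hρ, hyR, if_false, zero_mul, mul_zero]
      positivity
  rw [integral_const_mul] at e3
  rw [e0]
  have hK : ∫ y : EuclideanSpace ℝ (Fin d), ρ ‖y‖ * ⟪e, y⟫ ^ 2 = S / d := by
    rw [eq_div_iff hd0.ne', mul_comm]; exact hkeq
  rw [hK] at e3
  linarith

theorem stmt_16 (d : ℕ) (hd : 1 ≤ d) (α : ℝ) (hα : α ∈ Set.Ioo (0 : ℝ) 2)
    (hdα : 2 - α < (d : ℝ))
    (V : EuclideanSpace ℝ (Fin d) → ℝ) (v : ℝ → ℝ)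
    (hrad : ∀ x, V x = v ‖x‖)
    (hV : ContDiff ℝ 1 V)
    (hL1 : Integrable (fun y => Real.exp (-(V y)) * ‖gradient V y‖))
    (hCb : Continuous (fun y => Real.exp (-(V y)) * ‖gradient V y‖) ∧
      ∃ M : ℝ, ∀ y, Real.exp (-(V y)) * ‖gradient V y‖ ≤ M)
    (htail : ∃ M : ℝ, ∀ᶠ r in atTop, Real.exp (-(v r)) * r ^ ((d : ℝ) + α) ≤ M)
    (hr0 : BddAbove {r : ℝ | 0 < r ∧ deriv v r ≤ 0})
    (hint : IntegrableOn (fun r => Real.exp (-(v r)) * |deriv v r| * r ^ d) (Set.Ioi 0))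
    (hpos : 0 < ∫ r in Set.Ioi (0 : ℝ), Real.exp (-(v r)) * deriv v r * r ^ d)
    (β : ℝ) (hβ : β ∈ Set.Ioo 0 α) :
    ∃ C₁ C₂ : ℝ, 0 < C₁ ∧ 0 < C₂ ∧ ∀ x : EuclideanSpace ℝ (Fin d),
      -fracLapD d α (fun y => (1 + ‖y‖ ^ 2) ^ (β / 2)) x +
          ⟪fracDrift d α V x, gradient (fun y => (1 + ‖y‖ ^ 2) ^ (β / 2)) x⟫ ≤
        C₁ - C₂ * Real.exp (v ‖x‖) * (1 + ‖x‖) ^ (-((d : ℝ) + α)) *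
          (1 + ‖x‖ ^ 2) ^ (β / 2) := by
  obtain ⟨hα0, hα2⟩ := hα
  obtain ⟨L, hL0, hL⟩ := fracLap_bound d hd α ⟨hα0, hα2⟩ β hβ
  obtain ⟨hβ0, hβα⟩ := hβ
  obtain ⟨-, M, hM⟩ := hCb
  have hγ : 0 < (d : ℝ) + α - 2 := by linarith
  obtain ⟨N, hN0, hN⟩ := riesz_int d hd ((d : ℝ) + α - 2) hγ (by linarith) V hV hL1 M hM
  obtain ⟨X, c, hX1, hc0, hXc⟩ := drift_lower d hd ((d : ℝ) + α - 2) hγ V v hrad hV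
    (fun x => (hN x).1) hr0 hint hpos
  have hrC : 0 < rieszC d α := by
    unfold rieszC
    have h1 : 0 < Real.Gamma (((d : ℝ) - (2 - α)) / 2) := Real.Gamma_pos_of_pos (by linarith)
    have h2 : 0 < Real.Gamma ((2 - α) / 2) := Real.Gamma_pos_of_pos (by linarith)
    positivity
  set γ := (d : ℝ) + α - 2 with hγdef
  -- bound of `exp V` on the ball
  obtain ⟨K, hK⟩ := (isCompact_closedBall (0 : EuclideanSpace ℝ (Fin d)) X).exists_bound_of_continuousOn
    (f := fun x => Real.exp (V x)) (Real.continuous_exp.comp hV.continuous).continuousOn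
  have hK0 : 0 ≤ K := le_trans (norm_nonneg _) (hK 0 (by simp; linarith))
  set C₂ := rieszC d α * β * c with hC2
  have hC2pos : 0 < C₂ := by positivity
  set P := (1 + X ^ 2) ^ (β / 2) with hP
  have hPpos : 0 < P := by positivity
  refine ⟨L + rieszC d α * K * β * (N * X) + C₂ * K * P, C₂, by positivity, hC2pos, fun x => ?_⟩
  have hLx := hL x
  set J := ∫ y, (Real.exp (-(V y)) * ‖x - y‖ ^ (-γ)) • gradient V y with hJ
  have hdrift : ⟪fracDrift d α V x, gradient (fun y => (1 + ‖y‖ ^ 2) ^ (β / 2)) x⟫ =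
      -(rieszC d α * Real.exp (V x) * β * (1 + ‖x‖ ^ 2) ^ (β / 2 - 1) * ⟪J, x⟫) := by
    rw [gradient_V0]
    unfold fracDrift
    rw [real_inner_smul_left, real_inner_smul_right]
    ring
  rw [hdrift, ← hrad x]
  have hE := Real.exp_pos (V x)
  have h1x : 1 ≤ 1 + ‖x‖ ^ 2 := by nlinarith [sq_nonneg ‖x‖]
  have hdγ : -((d : ℝ) + α) = -γ - 2 := by rw [hγdef]; ring
  rw [hdγ]
  rcases le_total X ‖x‖ with hx | hx
  · have hx0 : 0 < ‖x‖ := by linarith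
    have hJx := hXc x hx
    have hk : (1 + ‖x‖) ^ (-γ - 2) * (1 + ‖x‖ ^ 2) ^ (β / 2) ≤
        (1 + ‖x‖ ^ 2) ^ (β / 2 - 1) * ‖x‖ ^ (-γ) := by
      rw [Real.rpow_sub (by positivity : 0 < 1 + ‖x‖), Real.rpow_sub_one (by positivity),
        Real.rpow_two]
      have h1 : (1 + ‖x‖) ^ (-γ) ≤ ‖x‖ ^ (-γ) :=
        Real.rpow_le_rpow_of_nonpos hx0 (by linarith) (by linarith)
      have h2 : 1 + ‖x‖ ^ 2 ≤ (1 + ‖x‖) ^ 2 := by nlinarith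
      calc (1 + ‖x‖) ^ (-γ) / (1 + ‖x‖) ^ 2 * (1 + ‖x‖ ^ 2) ^ (β / 2)
          ≤ ‖x‖ ^ (-γ) / (1 + ‖x‖ ^ 2) * (1 + ‖x‖ ^ 2) ^ (β / 2) := by gcongr
        _ = _ := by ring
    have h3 : C₂ * Real.exp (V x) * ((1 + ‖x‖) ^ (-γ - 2) * (1 + ‖x‖ ^ 2) ^ (β / 2)) ≤
        C₂ * Real.exp (V x) * ((1 + ‖x‖ ^ 2) ^ (β / 2 - 1) * ‖x‖ ^ (-γ)) := by gcongr
    have h4 : rieszC d α * Real.exp (V x) * β * (1 + ‖x‖ ^ 2) ^ (β / 2 - 1) * (c * ‖x‖ ^ (-γ)) ≤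
        rieszC d α * Real.exp (V x) * β * (1 + ‖x‖ ^ 2) ^ (β / 2 - 1) * ⟪J, x⟫ := by gcongr
    have h5 : C₂ * Real.exp (V x) * ((1 + ‖x‖ ^ 2) ^ (β / 2 - 1) * ‖x‖ ^ (-γ)) =
        rieszC d α * Real.exp (V x) * β * (1 + ‖x‖ ^ 2) ^ (β / 2 - 1) * (c * ‖x‖ ^ (-γ)) := by
      rw [hC2]; ring
    have h6 : 0 ≤ rieszC d α * K * β * (N * X) + C₂ * K * P := by positivity
    have h7 : C₂ * Real.exp (V x) * (1 + ‖x‖) ^ (-γ - 2) * (1 + ‖x‖ ^ 2) ^ (β / 2) =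
      C₂ * Real.exp (V x) * ((1 + ‖x‖) ^ (-γ - 2) * (1 + ‖x‖ ^ 2) ^ (β / 2)) := by ring
    rw [h7]
    linarith
  · have hVK : Real.exp (V x) ≤ K := by
      have := hK x (by simpa using hx)
      rwa [Real.norm_of_nonneg hE.le] at this
    have hq : (1 + ‖x‖ ^ 2) ^ (β / 2 - 1) ≤ 1 :=
      Real.rpow_le_one_of_one_le_of_nonpos h1x (by linarith)
    have hin : -⟪J, x⟫ ≤ N * X := by
      have h1 := neg_le_of_abs_le (abs_real_inner_le_norm J x)
      have h2 : ‖J‖ * ‖x‖ ≤ N * X := mul_le_mul (hN x).2 hx (norm_nonneg _) hN0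
      linarith
    have h1 : rieszC d α * Real.exp (V x) * β * (1 + ‖x‖ ^ 2) ^ (β / 2 - 1) * (-⟪J, x⟫) ≤
        rieszC d α * K * β * (N * X) := by
      calc _ ≤ rieszC d α * Real.exp (V x) * β * (1 + ‖x‖ ^ 2) ^ (β / 2 - 1) * (N * X) := by gcongr
        _ ≤ rieszC d α * K * β * 1 * (N * X) := by gcongr
        _ = _ := by ring
    have h2 : (1 + ‖x‖) ^ (-γ - 2) ≤ 1 :=
      Real.rpow_le_one_of_one_le_of_nonpos (by linarith [norm_nonneg x]) (by linarith)
    have h3 : (1 + ‖x‖ ^ 2) ^ (β / 2) ≤ P := by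
      rw [hP]; gcongr
    have h4 : C₂ * Real.exp (V x) * (1 + ‖x‖) ^ (-γ - 2) * (1 + ‖x‖ ^ 2) ^ (β / 2) ≤
        C₂ * K * P := by
      calc _ ≤ C₂ * K * 1 * P := by gcongr
        _ = _ := by ring
    linarith
end

section
/- Let d = 1 and α ∈ (0,1]. Let V ∈ C²(ℝ) be a symmetric function (V(x) = V(−x) for all x ∈ ℝ) such that e^{−V} ∈ L¹(ℝ; dx) ∩ C_b²(ℝ), satisfying: limsup_{r→∞} e^{−V(r)} r^{1+α} < ∞; limsup_{x→∞} x³ e^{−V(x)} |V'(x)² − V''(x)| < ∞; and liminf_{x→∞} x³ e^{−V(x)} (V'(x)² − V''(x)) ≥ 0. Fix β ∈ (0,α) and let V₀(x) := (1+x²)^{β/2}. Then there exist constants C₁, C₂ > 0 such that for all x ∈ ℝ: −(−Δ)^{α/2} V₀(x) + b(x) V₀'(x) ≤ C₁ − C₂ e^{V(x)} (1+|x|)^{−(1+α)} V₀(x). -/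
open MeasureTheory Real Filter

/-- The constant `c_{1,α} = 2^α Γ((1+α)/2)/(π^{1/2} |Γ(-α/2)|)`. -/
noncomputable def fracC (α : ℝ) : ℝ :=
  2 ^ α * Real.Gamma ((1 + α) / 2) / (Real.pi ^ ((1 : ℝ) / 2) * |Real.Gamma (-α / 2)|)

/-- The one-dimensional fractional Laplacian `(-Δ)^{α/2} g`, defined so that
`-(-Δ)^{α/2} g (x) = c_{1,α} ∫ (g(x+z) - g(x) - g'(x) z 1_{|z|≤1}) |z|^{-(1+α)} dz`. -/
noncomputable def fracLap1 (α : ℝ) (g : ℝ → ℝ) (x : ℝ) : ℝ :=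
  -(fracC α *
    ∫ z : ℝ, (g (x + z) - g x - deriv g x * z * (if |z| ≤ 1 then 1 else 0)) * |z| ^ (-(1 + α)))

/-- The one-dimensional fractional drift
`b(x) = -e^{V(x)} ∫_{-∞}^x (-Δ)^{α/2} e^{-V(u)} du`. -/
noncomputable def fracDrift1 (α : ℝ) (V : ℝ → ℝ) (x : ℝ) : ℝ :=
  -Real.exp (V x) * ∫ u in Set.Iic x, fracLap1 α (fun y => Real.exp (-(V y))) u

namespace S17

lemma near_integral (a γ : ℝ) (ha : 0 < a) (hγ : -1 < γ) :
    ∫ z : ℝ, (if |z| ≤ a then |z| ^ γ else 0) = 2 * (a ^ (γ + 1) / (γ + 1)) := by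
  rw [integral_comp_abs (f := fun z => if z ≤ a then z ^ γ else 0)]
  congr 1
  have h1 : ∫ x in Set.Ioi (0:ℝ), (if x ≤ a then x ^ γ else 0) = ∫ x in Set.Ioc 0 a, x ^ γ := by
    rw [← integral_indicator measurableSet_Ioi, ← integral_indicator measurableSet_Ioc]
    congr 1
    ext x
    by_cases h0 : 0 < x <;> by_cases h2 : x ≤ a <;> simp [Set.indicator, h0, h2]
  rw [h1, ← intervalIntegral.integral_of_le ha.le, integral_rpow (Or.inl hγ)]
  rw [Real.zero_rpow (by linarith), sub_zero]

lemma near_integrable (a γ : ℝ) (ha : 0 < a) (hγ : -1 < γ) :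
    Integrable (fun z : ℝ => if |z| ≤ a then |z| ^ γ else 0) := by
  by_contra h
  have h1 := near_integral a γ ha hγ
  rw [integral_undef h] at h1
  have : 0 < 2 * (a ^ (γ + 1) / (γ + 1)) := by
    have : 0 < γ + 1 := by linarith
    positivity
  linarith

lemma far_integral (a γ : ℝ) (ha : 0 < a) (hγ : γ < -1) :
    ∫ z : ℝ, (if |z| ≤ a then 0 else |z| ^ γ) = 2 * (-a ^ (γ + 1) / (γ + 1)) := by
  rw [integral_comp_abs (f := fun z => if z ≤ a then 0 else z ^ γ)]
  congr 1
  have h1 : ∫ x in Set.Ioi (0:ℝ), (if x ≤ a then 0 else x ^ γ) = ∫ x in Set.Ioi a, x ^ γ := by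
    rw [← integral_indicator measurableSet_Ioi, ← integral_indicator measurableSet_Ioi]
    congr 1
    ext x
    by_cases h2 : x ≤ a
    · simp [Set.indicator, h2]
    · have h0 : 0 < x := by linarith
      simp [Set.indicator, h0, h2, not_le.1 h2]
  rw [h1, integral_Ioi_rpow_of_lt hγ ha]

lemma far_integrable (a γ : ℝ) (ha : 0 < a) (hγ : γ < -1) :
    Integrable (fun z : ℝ => if |z| ≤ a then 0 else |z| ^ γ) := by
  by_contra h
  have h1 := far_integral a γ ha hγ
  rw [integral_undef h] at h1
  have : 0 < 2 * (-a ^ (γ + 1) / (γ + 1)) := by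
    have h2 : γ + 1 < 0 := by linarith
    have h3 : 0 < a ^ (γ + 1) := by positivity
    have := div_pos_of_neg_of_neg (neg_lt_zero.2 h3) h2
    linarith
  linarith

lemma second_diff_lower (q q' q'' : ℝ → ℝ) (h1 : ∀ x, HasDerivAt q (q' x) x)
    (h2 : ∀ x, HasDerivAt q' (q'' x) x) (u z m : ℝ)
    (hm : ∀ x, |x - u| ≤ |z| → -m ≤ q'' x) :
    -m * z ^ 2 ≤ q (u + z) + q (u - z) - 2 * q u := by
  have hconv : ConvexOn ℝ (Metric.closedBall u |z|) (fun x => q x + m / 2 * x ^ 2) := by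
    have hd1 : ∀ x, HasDerivAt (fun x => q x + m / 2 * x ^ 2) (q' x + m * x) x := by
      intro x
      have := (h1 x).add (((hasDerivAt_id x).pow 2).const_mul (m / 2))
      convert! this using 1
      simp; ring
    have hd2 : ∀ x, HasDerivAt (fun x => q' x + m * x) (q'' x + m) x := by
      intro x
      have := (h2 x).add (((hasDerivAt_id x)).const_mul m)
      convert! this using 1
      simp
    refine convexOn_of_hasDerivWithinAt2_nonneg (convex_closedBall _ _) ?_
      (fun x _ => (hd1 x).hasDerivWithinAt) (fun x _ => (hd2 x).hasDerivWithinAt) ?_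
    · exact fun x _ => (hd1 x).continuousAt.continuousWithinAt
    · intro x hx
      have := hm x (by simpa [Real.dist_eq] using Metric.mem_closedBall.1 (interior_subset hx))
      linarith
  have m1 : u + z ∈ Metric.closedBall u |z| := by simp
  have m2 : u - z ∈ Metric.closedBall u |z| := by simp
  have := hconv.2 m1 m2 (by norm_num : (0:ℝ) ≤ 1 / 2) (by norm_num : (0:ℝ) ≤ 1 / 2) (by norm_num)
  simp only [smul_eq_mul] at this
  rw [show 1 / 2 * (u + z) + 1 / 2 * (u - z) = u by ring] at this
  nlinarith

lemma second_diff_abs (q q' q'' : ℝ → ℝ) (h1 : ∀ x, HasDerivAt q (q' x) x)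
    (h2 : ∀ x, HasDerivAt q' (q'' x) x) (u z m : ℝ)
    (hm : ∀ x, |x - u| ≤ |z| → |q'' x| ≤ m) :
    |q (u + z) + q (u - z) - 2 * q u| ≤ m * z ^ 2 := by
  have a1 := second_diff_lower q q' q'' h1 h2 u z m (fun x hx => (abs_le.1 (hm x hx)).1)
  have a2 := second_diff_lower (fun x => -q x) (fun x => -q' x) (fun x => -q'' x)
    (fun x => (h1 x).neg) (fun x => (h2 x).neg) u z m
    (fun x hx => neg_le_neg (abs_le.1 (hm x hx)).2)
  rw [abs_le]
  constructor <;> linarith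

lemma taylor_abs (q q' q'' : ℝ → ℝ) (h1 : ∀ x, HasDerivAt q (q' x) x)
    (h2 : ∀ x, HasDerivAt q' (q'' x) x) (m : ℝ) (hm : ∀ x, |q'' x| ≤ m) (u z : ℝ) :
    |q (u + z) - q u - q' u * z| ≤ m * z ^ 2 := by
  have hm0 : 0 ≤ m := (abs_nonneg _).trans (hm 0)
  have hl : ∀ x y, |q' y - q' x| ≤ m * |y - x| := fun x y => by
    have := (convex_univ (𝕜 := ℝ) (E := ℝ)).norm_image_sub_le_of_norm_hasDerivWithin_le
      (f := q') (f' := q'') (C := m) (fun x _ => (h2 x).hasDerivWithinAt) (fun x _ => hm x)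
      (Set.mem_univ x) (Set.mem_univ y)
    simpa using this
  have := (convex_closedBall u |z|).norm_image_sub_le_of_norm_hasDerivWithin_le
      (f := fun t => q t - q' u * t) (f' := fun t => q' t - q' u) (C := m * |z|)
      (x := u) (y := u + z)
      (fun x _ => by
        have := (h1 x).sub ((hasDerivAt_id x).const_mul (q' u))
        simp only [mul_one] at this
        exact this.hasDerivWithinAt)
      (fun x hx => by
        have h3 : |x - u| ≤ |z| := by simpa [Real.dist_eq] using Metric.mem_closedBall.1 hx
        exact (hl u x).trans (mul_le_mul_of_nonneg_left h3 hm0))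
      (by simp) (by simp)
  simp only [Real.norm_eq_abs, add_sub_cancel_left] at this
  rw [mul_assoc, abs_mul_abs_self] at this
  rw [sq]
  convert this using 2
  ring

lemma fracC_pos (α : ℝ) (hα : α ∈ Set.Ioc (0 : ℝ) 1) : 0 < fracC α := by
  obtain ⟨h0, h1⟩ := hα
  unfold fracC
  have hg : 0 < Real.Gamma ((1 + α) / 2) := Real.Gamma_pos_of_pos (by linarith)
  have hn : Real.Gamma (-α / 2) ≠ 0 := by
    apply Real.Gamma_ne_zero
    intro m hm
    rcases m with _ | m
    · simp at hm; linarith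
    · push_cast at hm
      have : (0:ℝ) ≤ m := Nat.cast_nonneg m
      linarith
  have := abs_pos.2 hn
  have := Real.pi_pos
  positivity

lemma rpow_sq_mul (α z : ℝ) : z ^ 2 * |z| ^ (-(1 + α)) = |z| ^ (1 - α) ∨ z = 0 := by
  by_cases hz : z = 0
  · exact Or.inr hz
  · left
    have : 0 < |z| := abs_pos.2 hz
    rw [← sq_abs, ← Real.rpow_natCast, ← Real.rpow_add this]
    congr 1
    push_cast; ring

lemma sq_mul_le (α z : ℝ) (hα : α ≤ 1) : z ^ 2 * |z| ^ (-(1 + α)) ≤ |z| ^ (1 - α) := by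
  rcases rpow_sq_mul α z with h | h
  · exact h.le
  · subst h; simp; positivity

/-- The compensated integrand is dominated. -/
lemma comp_bound (α γ : ℝ) (hα : α ≤ 1) (g g' g'' : ℝ → ℝ)
    (h1 : ∀ x, HasDerivAt g (g' x) x)
    (h2 : ∀ x, HasDerivAt g' (g'' x) x) (m B : ℝ) (hm : ∀ x, |g'' x| ≤ m)
    (hB : ∀ x z, 1 < |z| → |g (x + z) - g x| ≤ B * |z| ^ γ) (x z : ℝ) :
    |(g (x + z) - g x - deriv g x * z * (if |z| ≤ 1 then 1 else 0)) * |z| ^ (-(1 + α))| ≤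
      m * (if |z| ≤ 1 then |z| ^ (1 - α) else 0) +
      B * (if |z| ≤ 1 then 0 else |z| ^ (γ - (1 + α))) := by
  have hm0 : 0 ≤ m := (abs_nonneg _).trans (hm 0)
  rw [(h1 x).deriv, abs_mul, abs_of_nonneg (a := |z| ^ (-(1 + α))) (by positivity)]
  by_cases hz : |z| ≤ 1
  · simp only [hz, if_true, mul_one, mul_zero, add_zero]
    calc _ ≤ (m * z ^ 2) * |z| ^ (-(1 + α)) :=
          mul_le_mul_of_nonneg_right (taylor_abs g g' g'' h1 h2 m hm x z) (by positivity)
      _ = m * (z ^ 2 * |z| ^ (-(1 + α))) := by ring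
      _ ≤ _ := mul_le_mul_of_nonneg_left (sq_mul_le α z hα) hm0
  · simp only [hz, if_false, mul_zero, zero_add, sub_zero]
    have hz' : 0 < |z| := by linarith [not_le.1 hz]
    calc _ ≤ (B * |z| ^ γ) * |z| ^ (-(1 + α)) :=
          mul_le_mul_of_nonneg_right (hB x z (not_le.1 hz)) (by positivity)
      _ = B * |z| ^ (γ - (1 + α)) := by
        rw [mul_assoc, ← Real.rpow_add hz']; rfl

lemma dom_integrable (α γ : ℝ) (h0 : 0 < α) (hα : α ≤ 1) (hγ : γ < α) (m B : ℝ) :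
    Integrable (fun z : ℝ => m * (if |z| ≤ 1 then |z| ^ (1 - α) else 0) +
      B * (if |z| ≤ 1 then 0 else |z| ^ (γ - (1 + α)))) :=
  ((near_integrable 1 (1 - α) one_pos (by linarith)).const_mul m).add
    ((far_integrable 1 (γ - (1 + α)) one_pos (by linarith)).const_mul B)

lemma V0_facts (β : ℝ) (h0 : 0 < β) (h1 : β ≤ 1) :
    ∃ g'' : ℝ → ℝ,
    (∀ x : ℝ, HasDerivAt (fun y : ℝ => (1 + y ^ 2) ^ (β / 2)) (β * x * (1 + x ^ 2) ^ (β / 2 - 1)) x) ∧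
    (∀ x : ℝ, HasDerivAt (fun x => β * x * (1 + x ^ 2) ^ (β / 2 - 1)) (g'' x) x) ∧
    (∀ x, |g'' x| ≤ 3) := by
  have hp : ∀ x : ℝ, HasDerivAt (fun y : ℝ => 1 + y ^ 2) (2 * x) x := fun x => by
    have := ((hasDerivAt_id x).pow 2).const_add 1
    simpa using this
  have hpos : ∀ x : ℝ, 0 < 1 + x ^ 2 := fun x => by positivity
  refine ⟨fun x => β * (1 + x ^ 2) ^ (β / 2 - 1) +
    β * x * (2 * x * (β / 2 - 1) * (1 + x ^ 2) ^ (β / 2 - 1 - 1)), ?_, ?_, ?_⟩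
  · intro x
    have := (hp x).rpow_const (p := β / 2) (Or.inl (hpos x).ne')
    convert this using 1
    ring
  · intro x
    have := ((hasDerivAt_id x).const_mul β).mul
      ((hp x).rpow_const (p := β / 2 - 1) (Or.inl (hpos x).ne'))
    convert! this using 1
    simp
  · intro x
    have e1 : (1 + x ^ 2) ^ (β / 2 - 1) ≤ 1 :=
      Real.rpow_le_one_of_one_le_of_nonpos (by nlinarith [sq_nonneg x]) (by linarith)
    have e2 : x ^ 2 * (1 + x ^ 2) ^ (β / 2 - 1 - 1) ≤ (1 + x ^ 2) ^ (β / 2 - 1) := by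
      rw [Real.rpow_sub_one (hpos x).ne' (β / 2 - 1), mul_div_assoc', div_le_iff₀ (hpos x)]
      nlinarith [Real.rpow_pos_of_pos (hpos x) (β / 2 - 1)]
    have e3 : 0 ≤ x ^ 2 * (1 + x ^ 2) ^ (β / 2 - 1 - 1) := by positivity
    have e4 : 0 ≤ (1 + x ^ 2) ^ (β / 2 - 1) := by positivity
    generalize hA : (1 + x ^ 2) ^ (β / 2 - 1) = A at *
    have e5 : β * x * (2 * x * (β / 2 - 1) * (1 + x ^ 2) ^ (β / 2 - 1 - 1)) =
      -(β * (2 - β) * (x ^ 2 * (1 + x ^ 2) ^ (β / 2 - 1 - 1))) := by ring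
    simp only [e5, hA]
    generalize x ^ 2 * (1 + x ^ 2) ^ (β / 2 - 1 - 1) = Bq at *
    have f1 : 0 ≤ β * (2 - β) := by nlinarith
    have f2 : β * (2 - β) ≤ 1 := by nlinarith [sq_nonneg (β - 1)]
    have f3 : 0 ≤ β * (2 - β) * Bq := by positivity
    have f4 : β * (2 - β) * Bq ≤ 1 := by nlinarith
    have f5 : 0 ≤ β * A := by positivity
    have f6 : β * A ≤ 1 := by nlinarith
    rw [abs_le]; constructor <;> linarith

lemma V0_holder (β : ℝ) (h0 : 0 < β) (h1 : β ≤ 1) (x z : ℝ) :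
    |(1 + (x + z) ^ 2) ^ (β / 2) - (1 + x ^ 2) ^ (β / 2)| ≤ 1 * |z| ^ β := by
  have key : ∀ x z : ℝ, (1 + (x + z) ^ 2) ^ (β / 2) ≤ (1 + x ^ 2) ^ (β / 2) + |z| ^ β := by
    intro x z
    have hs : ∀ y : ℝ, (1 + y ^ 2) ^ (β / 2) = (Real.sqrt (1 + y ^ 2)) ^ β := fun y => by
      rw [Real.sqrt_eq_rpow, ← Real.rpow_mul (by positivity)]
      congr 1; ring
    rw [hs, hs]
    have hle : Real.sqrt (1 + (x + z) ^ 2) ≤ Real.sqrt (1 + x ^ 2) + |z| := by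
      rw [Real.sqrt_le_left (by positivity)]
      have h3 : |x| ≤ Real.sqrt (1 + x ^ 2) := by
        apply Real.abs_le_sqrt; linarith
      have h4 : x * z ≤ |x| * |z| := by rw [← abs_mul]; exact le_abs_self _
      have h5 := Real.sq_sqrt (show 0 ≤ 1 + x ^ 2 by positivity)
      nlinarith [sq_abs z, mul_le_mul_of_nonneg_right h3 (abs_nonneg z)]
    calc _ ≤ (Real.sqrt (1 + x ^ 2) + |z|) ^ β := Real.rpow_le_rpow (by positivity) hle h0.le
      _ ≤ _ := Real.rpow_add_le_add_rpow (by positivity) (by positivity) h0.le h1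
  have a1 := key x z
  have a2 := key (x + z) (-z)
  rw [add_neg_cancel_right, abs_neg] at a2
  rw [abs_le]; constructor <;> linarith

lemma V0_bound (α β : ℝ) (hα : α ∈ Set.Ioc (0 : ℝ) 1) (hβ : β ∈ Set.Ioo 0 α) :
    ∃ C : ℝ, 0 < C ∧ ∀ x, -fracLap1 α (fun y => (1 + y ^ 2) ^ (β / 2)) x ≤ C := by
  have hβ1 : β ≤ 1 := hβ.2.le.trans hα.2
  obtain ⟨g'', h1, h2, h3⟩ := V0_facts β hβ.1 hβ1
  set K : ℝ → ℝ := fun z => 3 * (if |z| ≤ 1 then |z| ^ (1 - α) else 0) +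
      1 * (if |z| ≤ 1 then 0 else |z| ^ (β - (1 + α))) with hK
  have hc := fracC_pos α hα
  refine ⟨fracC α * |∫ z, K z| + 1, by positivity, fun x => ?_⟩
  have := norm_integral_le_of_norm_le (f := fun z => ((1 + (x + z) ^ 2) ^ (β / 2) - (1 + x ^ 2) ^ (β / 2) -
          deriv (fun y : ℝ => (1 + y ^ 2) ^ (β / 2)) x * z * (if |z| ≤ 1 then 1 else 0)) *
        |z| ^ (-(1 + α))) (dom_integrable α β hα.1 hα.2 hβ.2 3 1)
    (Eventually.of_forall (fun z => comp_bound α β hα.2 _ _ g'' h1 h2 3 1 h3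
      (fun x z _ => V0_holder β hβ.1 hβ1 x z) x z))
  unfold fracLap1
  rw [neg_neg]
  have h5 := (le_abs_self _).trans (this.trans (le_abs_self _))
  have := mul_le_mul_of_nonneg_left h5 hc.le
  linarith

lemma symm_form (α : ℝ) (hα : α ∈ Set.Ioc (0 : ℝ) 1) (p p' p'' : ℝ → ℝ)
    (h1 : ∀ x, HasDerivAt p (p' x) x) (h2 : ∀ x, HasDerivAt p' (p'' x) x) (M : ℝ)
    (hp0 : ∀ x, 0 ≤ p x) (hpM : ∀ x, p x ≤ M) (hm : ∀ x, |p'' x| ≤ M) (u : ℝ) :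
    Integrable (fun z => (p (u + z) + p (u - z) - 2 * p u) * |z| ^ (-(1 + α))) ∧
    fracLap1 α p u =
      -(fracC α / 2 * ∫ z, (p (u + z) + p (u - z) - 2 * p u) * |z| ^ (-(1 + α))) := by
  have hpc : Continuous p := continuous_iff_continuousAt.2 fun x => (h1 x).continuousAt
  set f : ℝ → ℝ := fun z =>
    (p (u + z) - p u - deriv p u * z * (if |z| ≤ 1 then 1 else 0)) * |z| ^ (-(1 + α)) with hf
  have hfm : Measurable f := by
    have hs : MeasurableSet {z : ℝ | |z| ≤ 1} := measurableSet_le measurable_norm measurable_const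
    refine Measurable.mul (Measurable.sub (by fun_prop) (Measurable.mul (by fun_prop) ?_))
      (by fun_prop)
    exact Measurable.ite hs measurable_const measurable_const
  have hfi : Integrable f := by
    refine Integrable.mono' (dom_integrable α 0 hα.1 hα.2 hα.1 M M) hfm.aestronglyMeasurable
      (Eventually.of_forall fun z => comp_bound α 0 hα.2 p p' p'' h1 h2 M M hm ?_ u z)
    intro x z _
    rw [Real.rpow_zero, mul_one, abs_le]
    constructor <;> linarith [hp0 x, hp0 (x + z), hpM x, hpM (x + z)]
  have hsum : ∀ z, f z + f (-z) = (p (u + z) + p (u - z) - 2 * p u) * |z| ^ (-(1 + α)) := by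
    intro z
    simp only [hf, abs_neg, ← sub_eq_add_neg]
    ring
  have hfi' : Integrable (fun z => f (-z)) := hfi.comp_neg
  refine ⟨?_, ?_⟩
  · simp_rw [← hsum]; exact hfi.add hfi'
  · simp_rw [← hsum]
    rw [integral_add hfi hfi', integral_neg_eq_self f]
    unfold fracLap1
    simp only [hf]
    ring

lemma prod_integrable (α : ℝ) (hα : α ∈ Set.Ioc (0 : ℝ) 1) (p p' p'' : ℝ → ℝ)
    (h1 : ∀ x, HasDerivAt p (p' x) x) (h2 : ∀ x, HasDerivAt p' (p'' x) x) (K : ℝ)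
    (hp0 : ∀ x, 0 ≤ p x) (hpi : Integrable p) (hm : ∀ x, |p'' x| ≤ K * (1 + x ^ 2)⁻¹) :
    Integrable (fun q : ℝ × ℝ => (p (q.1 + q.2) + p (q.1 - q.2) - 2 * p q.1) *
      |q.2| ^ (-(1 + α))) (volume.prod volume) := by
  have hpc : Continuous p := continuous_iff_continuousAt.2 fun x => (h1 x).continuousAt
  have hK : 0 ≤ K := by have := (abs_nonneg _).trans (hm 0); simpa using this
  have hn := near_integrable 1 (1 - α) one_pos (by linarith [hα.2])
  have hf := far_integrable 1 (-(1 + α)) one_pos (by linarith [hα.1])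
  set nr : ℝ → ℝ := fun z => if |z| ≤ 1 then |z| ^ (1 - α) else 0 with hnr
  set fr : ℝ → ℝ := fun z => if |z| ≤ 1 then 0 else |z| ^ (-(1 + α)) with hfr
  have i1 : Integrable (fun q : ℝ × ℝ => (3 * K * (1 + q.1 ^ 2)⁻¹) * nr q.2)
      (volume.prod volume) :=
    (integrable_inv_one_add_sq.const_mul (3 * K)).mul_prod hn
  have i2 : Integrable (fun q : ℝ × ℝ => p q.1 * fr q.2) (volume.prod volume) :=
    hpi.mul_prod hf
  have i3 : Integrable (fun q : ℝ × ℝ => fr q.2 * p (q.1 - q.2)) (volume.prod volume) := by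
    simpa using Integrable.convolution_integrand (ContinuousLinearMap.mul ℝ ℝ) hf hpi
  have i4 : Integrable (fun q : ℝ × ℝ => fr q.2 * p (q.1 + q.2)) (volume.prod volume) := by
    have mp : MeasurePreserving (Prod.map id (fun z : ℝ => -z) : ℝ × ℝ → ℝ × ℝ)
        (volume.prod volume) (volume.prod volume) :=
      (MeasurePreserving.id volume).prod (Measure.measurePreserving_neg volume)
    have := mp.integrable_comp_of_integrable i3
    refine this.congr (Eventually.of_forall fun q => ?_)
    simp [hfr, Function.comp]
  have itot := ((i1.add i4).add i3).add (i2.const_mul 2)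
  refine itot.mono' (Measurable.aestronglyMeasurable (by fun_prop)) (Eventually.of_forall ?_)
  rintro ⟨u, z⟩
  simp only [Pi.add_apply, hnr, hfr, Real.norm_eq_abs]
  rw [abs_mul, abs_of_nonneg (a := |z| ^ (-(1 + α))) (by positivity)]
  by_cases hz : |z| ≤ 1
  · simp only [hz, if_true, zero_mul, mul_zero, add_zero]
    have hd := second_diff_abs p p' p'' h1 h2 u z (3 * K * (1 + u ^ 2)⁻¹) ?_
    · calc _ ≤ (3 * K * (1 + u ^ 2)⁻¹ * z ^ 2) * |z| ^ (-(1 + α)) :=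
            mul_le_mul_of_nonneg_right hd (by positivity)
        _ = 3 * K * (1 + u ^ 2)⁻¹ * (z ^ 2 * |z| ^ (-(1 + α))) := by ring
        _ ≤ _ := mul_le_mul_of_nonneg_left (sq_mul_le α z hα.2) (by positivity)
    · intro x hx
      refine (hm x).trans ?_
      have hx1 : (x - u) ^ 2 ≤ 1 := by
        rw [← sq_abs]; have := hx.trans hz; nlinarith [abs_nonneg (x - u)]
      have : (1 + x ^ 2)⁻¹ ≤ 3 * (1 + u ^ 2)⁻¹ := by
        rw [← div_eq_mul_inv, inv_eq_one_div, div_le_div_iff₀ (by positivity) (by positivity)]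
        nlinarith [sq_nonneg (2 * x - u)]
      nlinarith
  · simp only [hz, if_false, mul_zero, zero_add]
    have : |p (u + z) + p (u - z) - 2 * p u| ≤ p (u + z) + p (u - z) + 2 * p u := by
      rw [abs_le]; constructor <;> linarith [hp0 (u + z), hp0 (u - z), hp0 u]
    have := mul_le_mul_of_nonneg_right this (show 0 ≤ |z| ^ (-(1 + α)) by positivity)
    linarith

lemma total_zero (α : ℝ) (p : ℝ → ℝ) (hpi : Integrable p)
    (hi : Integrable (fun q : ℝ × ℝ => (p (q.1 + q.2) + p (q.1 - q.2) - 2 * p q.1) *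
      |q.2| ^ (-(1 + α))) (volume.prod volume)) :
    ∫ u, ∫ z, (p (u + z) + p (u - z) - 2 * p u) * |z| ^ (-(1 + α)) = 0 := by
  rw [integral_integral_swap (f := fun u z => (p (u + z) + p (u - z) - 2 * p u) *
    |z| ^ (-(1 + α))) hi]
  have : ∀ z, ∫ u, (p (u + z) + p (u - z) - 2 * p u) * |z| ^ (-(1 + α)) = 0 := by
    intro z
    rw [integral_mul_const, integral_sub, integral_add, integral_add_right_eq_self p,
      integral_sub_right_eq_self p, integral_const_mul]
    · ring
    · exact hpi.comp_add_right z
    · exact hpi.comp_sub_right z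
    · exact (hpi.comp_add_right z).add (hpi.comp_sub_right z)
    · exact hpi.const_mul 2
  rw [integral_congr_ae (Eventually.of_forall this), integral_zero]

lemma lower_tail (α : ℝ) (hα : α ∈ Set.Ioc (0 : ℝ) 1) (p p' p'' : ℝ → ℝ)
    (h1 : ∀ x, HasDerivAt p (p' x) x) (h2 : ∀ x, HasDerivAt p' (p'' x) x)
    (hp0 : ∀ x, 0 < p x)
    (hi : ∀ u, Integrable (fun z => (p (u + z) + p (u - z) - 2 * p u) * |z| ^ (-(1 + α))))
    (htail : ∃ M : ℝ, ∀ᶠ r in atTop, p r * r ^ (1 + α) ≤ M)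
    (hliminf : ∀ ε : ℝ, 0 < ε → ∀ᶠ x in atTop, -ε ≤ x ^ 3 * p'' x) :
    ∃ κ R : ℝ, 0 < κ ∧ 1 ≤ R ∧ ∀ u, R ≤ u → κ * u ^ (-(1 + α)) ≤
      ∫ z, (p (u + z) + p (u - z) - 2 * p u) * |z| ^ (-(1 + α)) := by
  obtain ⟨h0, hα1⟩ := hα
  have hpc : Continuous p := continuous_iff_continuousAt.2 fun x => (h1 x).continuousAt
  set bump : ℝ → ℝ := fun w => if |w| ≤ 1 then p w else 0 with hbump
  have hbe : bump = (Set.Icc (-1:ℝ) 1).indicator p := by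
    ext w; simp [hbump, Set.indicator, abs_le]
  have hbi : Integrable bump := by
    rw [hbe, integrable_indicator_iff measurableSet_Icc]
    exact hpc.continuousOn.integrableOn_Icc
  set I : ℝ := ∫ w, bump w with hI
  have hIpos : 0 < I := by
    rw [hI, hbe, integral_indicator measurableSet_Icc, integral_Icc_eq_integral_Ioc,
      ← intervalIntegral.integral_of_le (by norm_num)]
    exact intervalIntegral.intervalIntegral_pos_of_pos (hpc.intervalIntegrable _ _) hp0 (by norm_num)
  obtain ⟨M, hM⟩ := htail
  have hMp : ∀ᶠ r in atTop, p r * r ^ (1 + α) ≤ |M| := hM.mono fun r hr => hr.trans (le_abs_self M)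
  set ε := I / 256 with hε
  have hεp : 0 < ε := by positivity
  obtain ⟨R1, hR1⟩ := eventually_atTop.1 (hliminf ε hεp)
  obtain ⟨R2, hR2⟩ := eventually_atTop.1 hMp
  have hlim : Tendsto (fun u : ℝ => 8 * |M| / α * u ^ (-α)) atTop (nhds 0) := by
    have := (tendsto_rpow_neg_atTop h0).const_mul (8 * |M| / α)
    simpa using this
  obtain ⟨R3, hR3⟩ := eventually_atTop.1 (hlim.eventually (gt_mem_nhds (show 0 < I / 16 by positivity)))
  refine ⟨I / 8, max (max 3 (2 * R1)) (max R2 R3), by positivity, ?_, ?_⟩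
  · exact le_trans (by norm_num) ((le_max_left _ _).trans (le_max_left _ _))
  intro u hu
  have hu3 : 3 ≤ u := ((le_max_left _ _).trans (le_max_left _ _)).trans hu
  have hu1 : 2 * R1 ≤ u := ((le_max_right _ _).trans (le_max_left _ _)).trans hu
  have hu2 : R2 ≤ u := ((le_max_left _ _).trans (le_max_right _ _)).trans hu
  have huR3 : R3 ≤ u := ((le_max_right _ _).trans (le_max_right _ _)).trans hu
  have hupos : 0 < u := by linarith
  have ha : 0 < u / 2 := by linarith
  set m : ℝ := 8 * ε / u ^ 3 with hmdef
  have hm0 : 0 ≤ m := by positivity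
  have hm : ∀ x, u / 2 ≤ x → -m ≤ p'' x := by
    intro x hx
    have hxp : 0 < x := by linarith
    have e1 := hR1 x (by linarith)
    have e2 : (u / 2) ^ 3 ≤ x ^ 3 := pow_le_pow_left₀ ha.le hx 3
    have e3 : -ε / x ^ 3 ≤ p'' x := by
      rw [div_le_iff₀ (by positivity)]; linarith
    have e4 : ε / x ^ 3 ≤ m := by
      rw [hmdef, div_le_div_iff₀ (by positivity) (by positivity)]
      have := mul_le_mul_of_nonneg_left e2 hεp.le
      nlinarith
    rw [neg_div] at e3
    linarith
  have j1 := near_integrable (u / 2) (1 - α) ha (by linarith)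
  have j2 := far_integrable (u / 2) (-(1 + α)) ha (by linarith)
  have v1 := near_integral (u / 2) (1 - α) ha (by linarith)
  have v2 := far_integral (u / 2) (-(1 + α)) ha (by linarith)
  have j3 : Integrable (fun z => bump (u - z)) := hbi.comp_sub_left u
  have v3 : ∫ z, bump (u - z) = I := integral_sub_left_eq_self bump volume u
  have hpt : ∀ z, -m * (if |z| ≤ u / 2 then |z| ^ (1 - α) else 0)
      - 2 * p u * (if |z| ≤ u / 2 then 0 else |z| ^ (-(1 + α)))
      + (2 * u) ^ (-(1 + α)) * bump (u - z) ≤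
      (p (u + z) + p (u - z) - 2 * p u) * |z| ^ (-(1 + α)) := by
    intro z
    have hw : 0 ≤ |z| ^ (-(1 + α)) := by positivity
    by_cases hz : |z| ≤ u / 2
    · have hb : bump (u - z) = 0 := by
        simp only [hbump]
        rw [if_neg]
        rw [not_le]
        have := le_abs_self (u - z)
        have := le_abs_self z
        linarith
      simp only [hz, if_true, hb, mul_zero, sub_zero, add_zero]
      have hd := second_diff_lower p p' p'' h1 h2 u z m (fun x hx => hm x (by
        have := (abs_le.1 (hx.trans hz)).1; linarith))
      have := mul_le_mul_of_nonneg_right hd hw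
      have e2 := mul_le_mul_of_nonneg_left (sq_mul_le α z hα1) hm0
      linarith
    · simp only [hz, if_false, mul_zero, zero_sub]
      have e1 : (2 * u) ^ (-(1 + α)) * bump (u - z) ≤ p (u - z) * |z| ^ (-(1 + α)) := by
        simp only [hbump]
        split_ifs with hb
        · rw [mul_comm]
          apply mul_le_mul_of_nonneg_left _ (hp0 _).le
          apply Real.rpow_le_rpow_of_nonpos (by linarith [not_le.1 hz]) _ (by linarith)
          have := abs_le.1 hb
          rw [abs_le]; constructor <;> linarith
        · rw [mul_zero]; exact mul_nonneg (hp0 _).le hw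
      have e2 : 0 ≤ p (u + z) * |z| ^ (-(1 + α)) := mul_nonneg (hp0 _).le hw
      linarith
  have hmono_int := integral_mono (((j1.const_mul (-m)).sub (j2.const_mul (2 * p u))).add
    (j3.const_mul ((2 * u) ^ (-(1 + α))))) (hi u) hpt
  refine le_trans ?_ hmono_int
  rw [integral_add' ((j1.const_mul (-m)).sub (j2.const_mul (2 * p u)))
    (j3.const_mul ((2 * u) ^ (-(1 + α)))), integral_sub' (j1.const_mul (-m)) (j2.const_mul (2 * p u)),
    integral_const_mul, integral_const_mul, integral_const_mul, v1, v2, v3]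
  set s := u ^ (-(1 + α)) with hs
  have hsp : 0 < s := by positivity
  -- first term
  have t1 : m * (2 * ((u / 2) ^ (1 - α + 1) / (1 - α + 1))) ≤ 16 * ε * s := by
    have b1 : (u / 2) ^ (1 - α + 1) / (1 - α + 1) ≤ u ^ (2 - α) := by
      rw [div_le_iff₀ (by linarith)]
      have c1 : (u / 2) ^ (1 - α + 1) ≤ u ^ (2 - α) := by
        rw [show 1 - α + 1 = 2 - α by ring]
        exact Real.rpow_le_rpow ha.le (by linarith) (by linarith)
      have : 0 ≤ u ^ (2 - α) := by positivity
      nlinarith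
    have b2 : u ^ (2 - α) = s * u ^ 3 := by
      rw [hs, ← Real.rpow_natCast u 3, ← Real.rpow_add hupos]
      congr 1; push_cast; ring
    rw [b2] at b1
    have := mul_le_mul_of_nonneg_left b1 hm0
    have e : m * (s * u ^ 3) = 8 * ε * s := by rw [hmdef]; field_simp
    linarith
  have t2 : 2 * p u * (2 * (-(u / 2) ^ (-(1 + α) + 1) / (-(1 + α) + 1))) ≤ I / 16 * s := by
    have b0 : p u ≤ |M| * s := by
      have := hR2 u hu2
      rw [hs, Real.rpow_neg hupos.le, ← div_eq_mul_inv, le_div_iff₀ (by positivity)]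
      exact this
    have b1 : (u / 2) ^ (-(1 + α) + 1) ≤ 2 * u ^ (-α) := by
      rw [show -(1 + α) + 1 = -α by ring, Real.div_rpow hupos.le (by norm_num),
        Real.rpow_neg (show (0:ℝ) ≤ 2 by norm_num), div_inv_eq_mul, mul_comm]
      apply mul_le_mul_of_nonneg_right _ (by positivity)
      calc (2:ℝ) ^ α ≤ 2 ^ (1:ℝ) := Real.rpow_le_rpow_of_exponent_le (by norm_num) hα1
        _ = 2 := by norm_num
    have b2 : -(u / 2) ^ (-(1 + α) + 1) / (-(1 + α) + 1) = (u / 2) ^ (-(1 + α) + 1) / α := by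
      rw [show -(1 + α) + 1 = -α by ring, neg_div_neg_eq]
    rw [b2]
    have b3 : (u / 2) ^ (-(1 + α) + 1) / α ≤ 2 * u ^ (-α) / α := by gcongr
    have b4 := hR3 u huR3
    calc _ ≤ 2 * (|M| * s) * (2 * (2 * u ^ (-α) / α)) := by
          gcongr
      _ = (8 * |M| / α * u ^ (-α)) * s := by ring
      _ ≤ _ := by gcongr
  have t3 : I / 4 * s ≤ (2 * u) ^ (-(1 + α)) * I := by
    rw [Real.mul_rpow (by norm_num) hupos.le, ← hs]
    have : (1 / 4 : ℝ) ≤ 2 ^ (-(1 + α)) := by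
      calc (1 / 4 : ℝ) = 2 ^ (-2 : ℝ) := by
            rw [Real.rpow_neg (by norm_num)]; norm_num
        _ ≤ _ := Real.rpow_le_rpow_of_exponent_le (by norm_num) (by linarith)
    have := mul_le_mul_of_nonneg_right this (mul_nonneg hsp.le hIpos.le)
    linarith
  have : 16 * ε * s = I / 16 * s := by rw [hε]; ring
  linarith [mul_pos hIpos hsp]

lemma drift_tail (α : ℝ) (h0 : 0 < α) (Ψ : ℝ → ℝ) (hΨi : Integrable Ψ)
    (hev : ∀ u, Ψ (-u) = Ψ u) (htot : ∫ u, Ψ u = 0) (κ R : ℝ) (hR : 1 ≤ R)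
    (hlow : ∀ u, R ≤ u → κ * u ^ (-(1 + α)) ≤ Ψ u) (x : ℝ) (hx : R ≤ x) :
    κ / α * x ^ (-α) ≤ ∫ u in Set.Iic (-x), Ψ u ∧
    ∫ u in Set.Iic x, Ψ u ≤ -(κ / α * x ^ (-α)) := by
  have hxp : 0 < x := by linarith
  have key : κ / α * x ^ (-α) ≤ ∫ u in Set.Ioi x, Ψ u := by
    have hi := (integrableOn_Ioi_rpow_of_lt (a := -(1 + α)) (by linarith) hxp).const_mul κ
    have hv := integral_Ioi_rpow_of_lt (a := -(1 + α)) (by linarith) hxp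
    have := setIntegral_mono_on hi hΨi.integrableOn measurableSet_Ioi
      (fun u hu => hlow u (hx.trans (le_of_lt hu)))
    rw [integral_const_mul, hv, show -(1 + α) + 1 = -α by ring, neg_div_neg_eq] at this
    refine le_trans (le_of_eq ?_) this
    ring
  have e1 : ∫ u in Set.Iic (-x), Ψ u = ∫ u in Set.Ioi x, Ψ u := by
    have := integral_comp_neg_Iic (-x) Ψ
    simp only [hev, neg_neg] at this
    exact this
  have e2 := intervalIntegral.integral_Iic_add_Ioi (b := x) hΨi.integrableOn hΨi.integrableOn
  rw [htot] at e2
  constructor <;> linarith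

/-- Final comparison for `x` away from the origin. -/
lemma pow_compare (α β k x : ℝ) (hk : 0 < k) (hβ : 0 < β) (hα : 0 < α) (hx : 1 ≤ x) :
    k * β / 2 * (1 + x) ^ (-(1 + α)) * (1 + x ^ 2) ^ (β / 2) ≤
      k * x ^ (-α) * (β * x * (1 + x ^ 2) ^ (β / 2 - 1)) := by
  have hxp : 0 < x := by linarith
  have hq : 0 < 1 + x ^ 2 := by positivity
  have e1 : (1 + x) ^ (-(1 + α)) ≤ x ^ (-(1 + α)) :=
    Real.rpow_le_rpow_of_nonpos hxp (by linarith) (by linarith)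
  have e2 : x ^ (-α) = x ^ (-(1 + α)) * x := by
    rw [show -α = -(1 + α) + 1 by ring, Real.rpow_add_one hxp.ne']
  rw [Real.rpow_sub_one hq.ne', e2]
  set s := x ^ (-(1 + α))
  set W := (1 + x ^ 2) ^ (β / 2)
  have hs : 0 < s := by positivity
  have hW : 0 < W := by positivity
  have e3 : (1:ℝ) / 2 ≤ x ^ 2 / (1 + x ^ 2) := by
    rw [div_le_div_iff₀ (by norm_num) hq]; nlinarith
  calc _ ≤ k * β / 2 * s * W := by gcongr
    _ = (k * β * s * W) * (1 / 2) := by ring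
    _ ≤ (k * β * s * W) * (x ^ 2 / (1 + x ^ 2)) := by gcongr
    _ = _ := by ring

end S17

theorem stmt_17 (α : ℝ) (hα : α ∈ Set.Ioc (0 : ℝ) 1)
    (V : ℝ → ℝ) (hV : ContDiff ℝ 2 V)
    (hsym : ∀ x : ℝ, V x = V (-x))
    (hL1 : Integrable (fun x => Real.exp (-(V x))))
    (hCb2 : ∃ M : ℝ, ∀ x : ℝ, Real.exp (-(V x)) ≤ M ∧
      |deriv (fun y => Real.exp (-(V y))) x| ≤ M ∧
      |deriv (deriv (fun y => Real.exp (-(V y)))) x| ≤ M)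
    (htail : ∃ M : ℝ, ∀ᶠ r in atTop, Real.exp (-(V r)) * r ^ (1 + α) ≤ M)
    (hlim : ∃ M R : ℝ, ∀ x : ℝ, R ≤ |x| →
      |x| ^ 3 * Real.exp (-(V x)) * |(deriv V x) ^ 2 - deriv (deriv V) x| ≤ M)
    (hliminf : ∀ ε : ℝ, 0 < ε → ∀ᶠ x in atTop,
      -ε ≤ x ^ 3 * Real.exp (-(V x)) * ((deriv V x) ^ 2 - deriv (deriv V) x))
    (β : ℝ) (hβ : β ∈ Set.Ioo 0 α) :
    ∃ C₁ C₂ : ℝ, 0 < C₁ ∧ 0 < C₂ ∧ ∀ x : ℝ,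
      -fracLap1 α (fun y => (1 + y ^ 2) ^ (β / 2)) x +
          fracDrift1 α V x * deriv (fun y => (1 + y ^ 2) ^ (β / 2)) x ≤
        C₁ - C₂ * Real.exp (V x) * (1 + |x|) ^ (-(1 + α)) * (1 + x ^ 2) ^ (β / 2) := by
  have hα' := hα
  obtain ⟨hα0, hα1⟩ := hα'
  obtain ⟨hβ0, hβα⟩ := hβ
  have hβ1 : β ≤ 1 := hβα.le.trans hα1
  -- derivatives of `p = exp (-V)`
  have hd1 : ∀ x, HasDerivAt V (deriv V x) x := fun x =>
    (hV.differentiable (by norm_num) x).hasDerivAt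
  have hV' : ContDiff ℝ 1 (deriv V) := by
    have : ContDiff ℝ (1 + 1) V := by norm_num; exact hV
    exact (contDiff_succ_iff_deriv.1 this).2.2
  have hd2 : ∀ x, HasDerivAt (deriv V) (deriv (deriv V) x) x := fun x =>
    (hV'.differentiable (by norm_num) x).hasDerivAt
  set p : ℝ → ℝ := fun y => Real.exp (-(V y)) with hp
  set p' : ℝ → ℝ := fun y => -(Real.exp (-(V y)) * deriv V y) with hp'
  set p'' : ℝ → ℝ := fun y => Real.exp (-(V y)) * ((deriv V y) ^ 2 - deriv (deriv V) y) with hp''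
  have h1 : ∀ x, HasDerivAt p (p' x) x := fun x => by
    have := (hd1 x).neg.exp
    have e : Real.exp ((-V) x) * -deriv V x = p' x := by simp [hp']
    rw [e] at this
    exact this
  have h2 : ∀ x, HasDerivAt p' (p'' x) x := fun x => by
    have := ((h1 x).mul (hd2 x)).neg
    convert! this using 1
    simp [hp', hp'', hp]; ring
  have e1 : deriv p = p' := funext fun x => (h1 x).deriv
  have e2 : deriv p' = p'' := funext fun x => (h2 x).deriv
  have hp0 : ∀ x, 0 < p x := fun x => Real.exp_pos _
  obtain ⟨M, hM⟩ := hCb2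
  have hpM : ∀ x, p x ≤ M := fun x => (hM x).1
  have hm : ∀ x, |p'' x| ≤ M := fun x => by
    have := (hM x).2.2
    rwa [e1, e2] at this
  have hM0 : 0 ≤ M := (abs_nonneg _).trans (hm 0)
  obtain ⟨M', R', hlim⟩ := hlim
  have hdecay : ∃ K : ℝ, ∀ x, |p'' x| ≤ K * (1 + x ^ 2)⁻¹ := by
    refine ⟨2 * |M'| + M * (1 + (max R' 1) ^ 2), fun x => ?_⟩
    rw [← div_eq_mul_inv, le_div_iff₀ (by positivity)]
    by_cases hx : max R' 1 ≤ |x|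
    · have hx1 : 1 ≤ |x| := (le_max_right _ _).trans hx
      have a1 := hlim x ((le_max_left _ _).trans hx)
      have a2 : |x| ^ 3 * |p'' x| ≤ |M'| := by
        refine le_trans (le_of_eq ?_) (a1.trans (le_abs_self M'))
        simp only [hp'', abs_mul, abs_of_pos (Real.exp_pos _)]
        ring
      have a3 : 1 + x ^ 2 ≤ 2 * |x| ^ 3 := by
        rw [← sq_abs]; nlinarith [sq_nonneg (|x|)]
      have a4 := mul_le_mul_of_nonneg_left a3 (abs_nonneg (p'' x))
      have : 0 ≤ M * (1 + (max R' 1) ^ 2) := by positivity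
      nlinarith
    · have a3 : x ^ 2 ≤ (max R' 1) ^ 2 := by
        rw [← sq_abs]
        exact pow_le_pow_left₀ (abs_nonneg x) (not_le.1 hx).le 2
      have : |p'' x| * (1 + x ^ 2) ≤ M * (1 + (max R' 1) ^ 2) :=
        mul_le_mul (hm x) (by linarith) (by positivity) hM0
      have := abs_nonneg M'
      linarith
  obtain ⟨K, hK⟩ := hdecay
  have hprod := S17.prod_integrable α hα p p' p'' h1 h2 K (fun x => (hp0 x).le) hL1 hK
  have hsymm := S17.symm_form α hα p p' p'' h1 h2 M (fun x => (hp0 x).le) hpM hm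
  obtain ⟨κ, R, hκ, hR, hlow⟩ := S17.lower_tail α hα p p' p'' h1 h2 hp0 (fun u => (hsymm u).1)
    htail (fun ε hε => (hliminf ε hε).mono fun x hx => by
      simp only [hp'']; linarith)
  set Ψ : ℝ → ℝ := fun u => ∫ z, (p (u + z) + p (u - z) - 2 * p u) * |z| ^ (-(1 + α)) with hΨ
  have hΨi : Integrable Ψ := hprod.integral_prod_left
  have htot : ∫ u, Ψ u = 0 := S17.total_zero α p hL1 hprod
  have hpev : ∀ x, p (-x) = p x := fun x => by simp only [hp]; rw [← hsym x]
  have hΨev : ∀ u, Ψ (-u) = Ψ u := fun u => by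
    refine integral_congr_ae (Eventually.of_forall fun z => ?_)
    show (p (-u + z) + p (-u - z) - 2 * p (-u)) * |z| ^ (-(1 + α)) =
      (p (u + z) + p (u - z) - 2 * p u) * |z| ^ (-(1 + α))
    rw [show -u + z = -(u - z) by ring, show -u - z = -(u + z) by ring, hpev, hpev, hpev]
    ring
  have hc := S17.fracC_pos α hα
  have hdrift : ∀ x, fracDrift1 α V x = Real.exp (V x) * (fracC α / 2) * ∫ u in Set.Iic x, Ψ u := by
    intro x
    unfold fracDrift1
    have : ∀ u, fracLap1 α p u = -(fracC α / 2) * Ψ u := fun u => by rw [(hsymm u).2]; ring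
    change -Real.exp (V x) * (∫ u in Set.Iic x, fracLap1 α p u) = _
    simp only [this]
    rw [integral_const_mul]
    ring
  obtain ⟨C, hC, hV0⟩ := S17.V0_bound α β hα ⟨hβ0, hβα⟩
  obtain ⟨g'', hg1, -, -⟩ := S17.V0_facts β hβ0 hβ1
  have hW' : ∀ x : ℝ, deriv (fun y : ℝ => (1 + y ^ 2) ^ (β / 2)) x =
      β * x * (1 + x ^ 2) ^ (β / 2 - 1) := fun x => (hg1 x).deriv
  set k : ℝ := fracC α / 2 * (κ / α) with hk
  have hkp : 0 < k := by positivity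
  set T : ℝ := ∫ u, |Ψ u| with hT
  have hT0 : 0 ≤ T := integral_nonneg fun u => abs_nonneg _
  have hFT : ∀ x, |∫ u in Set.Iic x, Ψ u| ≤ T := fun x => by
    refine (abs_integral_le_integral_abs).trans ?_
    exact setIntegral_le_integral hΨi.abs (Eventually.of_forall fun u => abs_nonneg _)
  have hVc : Continuous V := hV.continuous
  -- bound on the compact region
  obtain ⟨B, hB⟩ : ∃ B : ℝ, ∀ x ∈ Set.Icc (-R) R,
      Real.exp (V x) * (fracC α / 2 * T * |β * x * (1 + x ^ 2) ^ (β / 2 - 1)| +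
        k * β / 2 * (1 + |x|) ^ (-(1 + α)) * (1 + x ^ 2) ^ (β / 2)) ≤ B := by
    have hcont : Continuous fun x : ℝ =>
      Real.exp (V x) * (fracC α / 2 * T * |β * x * (1 + x ^ 2) ^ (β / 2 - 1)| +
        k * β / 2 * (1 + |x|) ^ (-(1 + α)) * (1 + x ^ 2) ^ (β / 2)) := by
      have c1 : ∀ r : ℝ, Continuous fun x : ℝ => (1 + x ^ 2) ^ r := fun r =>
        (by fun_prop : Continuous fun x : ℝ => 1 + x ^ 2).rpow_const
          fun x => Or.inl (by positivity)
      have c2 : Continuous fun x : ℝ => (1 + |x|) ^ (-(1 + α)) :=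
        (by fun_prop : Continuous fun x : ℝ => 1 + |x|).rpow_const
          fun x => Or.inl (by positivity)
      have c3 := c1 (β / 2 - 1)
      have c4 := c1 (β / 2)
      fun_prop
    obtain ⟨B, hB⟩ := (isCompact_Icc (a := -R) (b := R)).bddAbove_image hcont.continuousOn
    exact ⟨B, fun x hx => hB (Set.mem_image_of_mem _ hx)⟩
  refine ⟨C + |B|, k * β / 2, by positivity, by positivity, fun x => ?_⟩
  have hv := hV0 x
  have hE : 0 < Real.exp (V x) := Real.exp_pos _
  rw [hW', hdrift]
  have hB0 := abs_nonneg B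
  suffices hs : Real.exp (V x) * (fracC α / 2) * (∫ u in Set.Iic x, Ψ u) *
      (β * x * (1 + x ^ 2) ^ (β / 2 - 1)) ≤
      |B| - k * β / 2 * Real.exp (V x) * (1 + |x|) ^ (-(1 + α)) * (1 + x ^ 2) ^ (β / 2) by
    linarith
  by_cases hxR : |x| ≤ R
  · have b1 := (hB x (abs_le.1 hxR)).trans (le_abs_self B)
    have b2 : (∫ u in Set.Iic x, Ψ u) * (β * x * (1 + x ^ 2) ^ (β / 2 - 1)) ≤
        T * |β * x * (1 + x ^ 2) ^ (β / 2 - 1)| := by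
      refine (le_abs_self _).trans ?_
      rw [abs_mul]
      exact mul_le_mul_of_nonneg_right (hFT x) (abs_nonneg _)
    have b3 := mul_le_mul_of_nonneg_left b2 (show 0 ≤ Real.exp (V x) * (fracC α / 2) by positivity)
    linarith
  · rw [not_le] at hxR
    have hx1 : 1 ≤ |x| := hR.trans hxR.le
    have hcmp := S17.pow_compare α β k |x| hkp hβ0 hα0 hx1
    obtain ⟨d1, d2⟩ := S17.drift_tail α hα0 Ψ hΨi hΨev htot κ R hR hlow |x| hxR.le
    rw [sq_abs] at hcmp
    set A := (1 + x ^ 2) ^ (β / 2 - 1) with hA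
    have hAp : 0 < A := by positivity
    have key : (∫ u in Set.Iic x, Ψ u) * (β * x * A) ≤
        -(κ / α * |x| ^ (-α) * (β * |x| * A)) := by
      have hnn : 0 ≤ β * |x| * A := by positivity
      rcases le_total 0 x with h | h
      · rw [abs_of_nonneg h] at *
        have := mul_le_mul_of_nonneg_right d2 hnn
        linarith
      · rw [abs_of_nonpos h] at *
        rw [neg_neg] at d1
        have := mul_le_mul_of_nonneg_right d1 hnn
        linarith
    have k1 := mul_le_mul_of_nonneg_left key (show 0 ≤ Real.exp (V x) * (fracC α / 2) by positivity)
    have k2 := mul_le_mul_of_nonneg_left hcmp hE.le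
    have k3 : Real.exp (V x) * (k * |x| ^ (-α) * (β * |x| * A)) =
      Real.exp (V x) * (fracC α / 2) * (κ / α * |x| ^ (-α) * (β * |x| * A)) := by rw [hk]; ring
    linarith
end

section
/- Let d ≥ 1 be an integer and α ∈ (0,2) with d > 2−α. Let V ∈ C¹(ℝ^d) be such that e^{−V} ∈ L¹(ℝ^d; dx) ∩ C_b(ℝ^d) and e^{−V}|∇V| ∈ L¹(ℝ^d; dx) ∩ C_b(ℝ^d). Then for every f ∈ C_c^∞(ℝ^d): ∫_{ℝ^d} [ −(−Δ)^{α/2} f(x) + ⟨b(x), ∇f(x)⟩ ] e^{−V(x)} dx = 0. In other words, the probability measure μ(dx) = Z^{−1} e^{−V(x)} dx with Z = ∫_{ℝ^d} e^{−V(x)} dx is infinitesimally invariant for the generator L f = −(−Δ)^{α/2} f + ⟨b, ∇f⟩ on C_c^∞(ℝ^d). -/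
open MeasureTheory Real Filter
open scoped RealInnerProductSpace

theorem aux_ibp {d : ℕ} {φ ψ : EuclideanSpace ℝ (Fin d) → ℝ} (v : EuclideanSpace ℝ (Fin d))
    (hφ : ContDiff ℝ 1 φ) (hψ : ContDiff ℝ 1 ψ) (hc : HasCompactSupport ψ) :
    ∫ x, φ x * fderiv ℝ ψ x v = - ∫ x, fderiv ℝ φ x v * ψ x := by
  have cφ := hφ.continuous
  have cψ := hψ.continuous
  have cφ' : Continuous (fun x => fderiv ℝ φ x v) :=
    (hφ.continuous_fderiv one_ne_zero).clm_apply continuous_const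
  have cψ' : Continuous (fun x => fderiv ℝ ψ x v) :=
    (hψ.continuous_fderiv one_ne_zero).clm_apply continuous_const
  apply integral_mul_fderiv_eq_neg_fderiv_mul_of_integrable
  · exact (cφ'.mul cψ).integrable_of_hasCompactSupport hc.mul_left
  · exact (cφ.mul cψ').integrable_of_hasCompactSupport (hc.fderiv_apply ℝ v).mul_left
  · exact (cφ.mul cψ).integrable_of_hasCompactSupport hc.mul_left
  · intro x _; exact hφ.differentiable one_ne_zero x
  · intro x _; exact hψ.differentiable one_ne_zero x

/-- The regularised kernel. -/
noncomputable def auxK (d : ℕ) (p q ε : ℝ) (z : EuclideanSpace ℝ (Fin d)) : ℝ :=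
  (‖z‖ ^ 2 + ε) ^ (-p / 2 - q)

theorem auxK_contDiff {d : ℕ} {p q ε : ℝ} (hε : 0 < ε) : ContDiff ℝ (⊤ : ℕ∞) (auxK d p q ε) := by
  unfold auxK
  refine ContDiff.rpow_const_of_ne ?_ ?_
  · exact (contDiff_norm_sq ℝ).add contDiff_const
  · intro x; positivity

theorem auxK_fderiv {d : ℕ} {p q ε : ℝ} (hε : 0 < ε) (z v : EuclideanSpace ℝ (Fin d)) :
    fderiv ℝ (auxK d p q ε) z v = (-p - 2 * q) * ⟪z, v⟫ * auxK d p (q + 1) ε z := by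
  have h1 : HasFDerivAt (fun z : EuclideanSpace ℝ (Fin d) => ‖z‖ ^ 2 + ε) (2 • innerSL ℝ z) z :=
    (HasStrictFDerivAt.hasFDerivAt (hasStrictFDerivAt_norm_sq z)).add_const ε
  have h2 := h1.rpow_const (p := -p / 2 - q) (Or.inl (by positivity))
  have h3 : fderiv ℝ (auxK d p q ε) z = _ := h2.fderiv
  rw [h3]
  simp only [auxK, _root_.smul_apply, innerSL_apply_apply, smul_eq_mul, nsmul_eq_mul]
  rw [show -p / 2 - (q + 1) = -p / 2 - q - 1 by ring]
  push_cast
  ring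

/-- Laplacian of the regularised kernel. -/
noncomputable def auxL (d : ℕ) (p ε : ℝ) (z : EuclideanSpace ℝ (Fin d)) : ℝ :=
  -p * d * (‖z‖ ^ 2 + ε) ^ (-p / 2 - 1) + p * (p + 2) * ‖z‖ ^ 2 * (‖z‖ ^ 2 + ε) ^ (-p / 2 - 2)

theorem aux_inner_single {d : ℕ} (z : EuclideanSpace ℝ (Fin d)) (i : Fin d) :
    ⟪z, EuclideanSpace.single i (1 : ℝ)⟫ = z i := by
  simp [EuclideanSpace.inner_single_right]

theorem aux_sum {d : ℕ} {p ε : ℝ} (hε : 0 < ε) (z : EuclideanSpace ℝ (Fin d)) :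
    ∑ i : Fin d, fderiv ℝ (fun w => fderiv ℝ (auxK d p 0 ε) w (EuclideanSpace.single i 1)) z
      (EuclideanSpace.single i 1) = auxL d p ε z := by
  have h : ∀ i : Fin d, fderiv ℝ (fun w => fderiv ℝ (auxK d p 0 ε) w (EuclideanSpace.single i 1)) z
      (EuclideanSpace.single i 1) = -p * auxK d p 1 ε z + p * (p + 2) * z i ^ 2 * auxK d p 2 ε z := by
    intro i
    have e1 : (fun w => fderiv ℝ (auxK d p 0 ε) w (EuclideanSpace.single i 1)) =
        fun w => (-p * ⟪w, EuclideanSpace.single i (1 : ℝ)⟫) * auxK d p 1 ε w := by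
      funext w
      rw [auxK_fderiv hε]; norm_num
    rw [e1]
    have d1 : HasFDerivAt (fun w : EuclideanSpace ℝ (Fin d) => -p * ⟪w, EuclideanSpace.single i (1 : ℝ)⟫)
        ((-p) • innerSL ℝ (EuclideanSpace.single i (1 : ℝ))) z := by
      have : (fun w : EuclideanSpace ℝ (Fin d) => -p * ⟪w, EuclideanSpace.single i (1 : ℝ)⟫) =
        fun w => ((-p) • innerSL ℝ (EuclideanSpace.single i (1 : ℝ))) w := by
        funext w; simp [real_inner_comm]
      rw [this]
      exact ContinuousLinearMap.hasFDerivAt _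
    have d2 : HasFDerivAt (auxK d p 1 ε) _ z :=
      (((auxK_contDiff (d := d) (p := p) (q := 1) hε).differentiable (by simp)) z).hasFDerivAt
    have d3 := (d1.mul d2).fderiv
    have e2 : fderiv ℝ (fun w => (-p * ⟪w, EuclideanSpace.single i (1 : ℝ)⟫) * auxK d p 1 ε w) z = _ := d3
    rw [e2]
    simp only [_root_.add_apply, _root_.smul_apply, auxK_fderiv hε, aux_inner_single, innerSL_apply_apply, smul_eq_mul]
    simp only [PiLp.single_apply, if_true]
    norm_num
    ring
  rw [Finset.sum_congr rfl (fun i _ => h i), Finset.sum_add_distrib, Finset.sum_const, ← Finset.sum_mul, ← Finset.mul_sum,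
    ← EuclideanSpace.real_norm_sq_eq]
  simp only [auxL, auxK, Finset.card_univ, Fintype.card_fin, nsmul_eq_mul]
  ring

theorem aux_ibp2 {d : ℕ} {p ε : ℝ} (hε : 0 < ε) {g : EuclideanSpace ℝ (Fin d) → ℝ}
    (hg : ContDiff ℝ (⊤ : ℕ∞) g) (hc : HasCompactSupport g) :
    ∫ z, auxK d p 0 ε z * ∑ i : Fin d, fderiv ℝ (fun w => fderiv ℝ g w (EuclideanSpace.single i 1)) z
      (EuclideanSpace.single i 1) = ∫ z, auxL d p ε z * g z := by
  have D : ∀ (φ : EuclideanSpace ℝ (Fin d) → ℝ) (v : EuclideanSpace ℝ (Fin d)),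
    ContDiff ℝ (⊤ : ℕ∞) φ → ContDiff ℝ (⊤ : ℕ∞) (fun w => fderiv ℝ φ w v) := by
    intro φ v h
    exact (h.fderiv_right (m := (⊤ : ℕ∞)) (by simp)).clm_apply contDiff_const
  have one : ∀ (φ : EuclideanSpace ℝ (Fin d) → ℝ), ContDiff ℝ (⊤ : ℕ∞) φ → ContDiff ℝ 1 φ :=
    fun φ h => h.of_le (by simp)
  have hK := auxK_contDiff (d := d) (p := p) (q := 0) hε
  simp_rw [← aux_sum hε, Finset.mul_sum, Finset.sum_mul]
  rw [integral_finsetSum, integral_finsetSum]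
  · refine Finset.sum_congr rfl fun i _ => ?_
    rw [aux_ibp _ (one _ hK) (one _ (D _ _ hg)) (hc.fderiv_apply ℝ _),
      aux_ibp _ (one _ (D _ _ hK)) (one _ hg) hc, neg_neg]
  · intro i _
    exact ((D _ _ (D _ _ hK)).continuous.mul hg.continuous).integrable_of_hasCompactSupport hc.mul_left
  · intro i _
    exact (hK.continuous.mul (D _ _ (D _ _ hg)).continuous).integrable_of_hasCompactSupport
      ((hc.fderiv_apply ℝ _).fderiv_apply ℝ _).mul_left

theorem auxL_bound {d : ℕ} {p ε : ℝ} (hp : 0 < p) (hε : 0 < ε) (z : EuclideanSpace ℝ (Fin d)) :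
    |auxL d p ε z| ≤ (p * d + p * (p + 2)) * (‖z‖ ^ 2 + ε) ^ (-p / 2 - 1) := by
  have hpos : 0 < ‖z‖ ^ 2 + ε := by positivity
  have h0 : 0 ≤ (‖z‖ ^ 2 + ε) ^ (-p / 2 - 1) := by positivity
  have h2 : 0 ≤ (‖z‖ ^ 2 + ε) ^ (-p / 2 - 2) := by positivity
  have h1 : ‖z‖ ^ 2 * (‖z‖ ^ 2 + ε) ^ (-p / 2 - 2) ≤ (‖z‖ ^ 2 + ε) ^ (-p / 2 - 1) := by
    have e : (‖z‖ ^ 2 + ε) ^ (-p / 2 - 1) = (‖z‖ ^ 2 + ε) * (‖z‖ ^ 2 + ε) ^ (-p / 2 - 2) := by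
      rw [← Real.rpow_one_add' hpos.le (by linarith)]
      congr 1; ring
    rw [e]
    gcongr
    linarith
  have h1' : 0 ≤ ‖z‖ ^ 2 * (‖z‖ ^ 2 + ε) ^ (-p / 2 - 2) := by positivity
  have hd : (0 : ℝ) ≤ d := Nat.cast_nonneg d
  have a1 : 0 ≤ p * d * (‖z‖ ^ 2 + ε) ^ (-p / 2 - 1) := by positivity
  have a2 : 0 ≤ p * (p + 2) * (‖z‖ ^ 2 * (‖z‖ ^ 2 + ε) ^ (-p / 2 - 2)) := by positivity
  have a3 : p * (p + 2) * (‖z‖ ^ 2 * (‖z‖ ^ 2 + ε) ^ (-p / 2 - 2)) ≤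
    p * (p + 2) * (‖z‖ ^ 2 + ε) ^ (-p / 2 - 1) := by gcongr
  unfold auxL
  rw [abs_le]
  constructor <;> nlinarith

theorem auxL_continuous {d : ℕ} {p ε : ℝ} (hε : 0 < ε) : Continuous (auxL d p ε) := by
  have h : ∀ q : ℝ, Continuous (fun z : EuclideanSpace ℝ (Fin d) => (‖z‖ ^ 2 + ε) ^ q) := by
    intro q
    refine Continuous.rpow_const (by fun_prop) ?_
    intro x; left; positivity
  unfold auxL
  have := h (-p / 2 - 1)
  have := h (-p / 2 - 2)
  fun_prop

theorem auxL_integrable {d : ℕ} {p ε : ℝ} (hp : 0 < p) (hpd : (d : ℝ) < p + 2) (hε : 0 < ε) :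
    Integrable (auxL d p ε) := by
  have hJ : Integrable (fun z : EuclideanSpace ℝ (Fin d) => ((1 : ℝ) + ‖z‖ ^ 2) ^ (-(p + 2) / 2)) :=
    integrable_rpow_neg_one_add_norm_sq (by simpa using hpd)
  refine (hJ.const_mul ((p * d + p * (p + 2)) * (min 1 ε) ^ (-p / 2 - 1))).mono'
    (auxL_continuous hε).aestronglyMeasurable (Eventually.of_forall fun z => ?_)
  refine (auxL_bound hp hε z).trans ?_
  rw [mul_assoc]
  have hm : 0 < min 1 ε := lt_min one_pos hε
  gcongr
  rw [show -(p + 2) / 2 = -p / 2 - 1 by ring, ← Real.mul_rpow hm.le (by positivity)]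
  apply Real.rpow_le_rpow_of_nonpos (by positivity)
  · have := min_le_left 1 ε
    have := min_le_right 1 ε
    nlinarith [sq_nonneg ‖z‖]
  · linarith

theorem auxL_integral {d : ℕ} (hd : 1 ≤ d) {p ε : ℝ} (hp : 0 < p) (hpd : (d : ℝ) < p + 2)
    (hε : 0 < ε) : ∫ z, auxL d p ε z = 0 := by
  have : Nonempty (Fin d) := ⟨⟨0, hd⟩⟩
  let F : ℝ → ℝ := fun r => -p * d * (r ^ 2 + ε) ^ (-p / 2 - 1) +
    p * (p + 2) * r ^ 2 * (r ^ 2 + ε) ^ (-p / 2 - 2)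
  have hI : Integrable (fun z : EuclideanSpace ℝ (Fin d) => F ‖z‖) := auxL_integrable hp hpd hε
  have hI2 := (integrable_fun_norm_addHaar volume (f := F)).1 hI
  have hE : ∫ z : EuclideanSpace ℝ (Fin d), F ‖z‖ = _ := integral_fun_norm_addHaar volume F
  have hz : ∫ y in Set.Ioi (0 : ℝ), y ^ (Module.finrank ℝ (EuclideanSpace ℝ (Fin d)) - 1) • F y = 0 := by
    have := integral_Ioi_of_hasDerivAt_of_tendsto' (a := (0 : ℝ)) (m := 0)
      (f := fun y => -p * y ^ d * (y ^ 2 + ε) ^ (-p / 2 - 1)) (f' := fun y => y ^ (Module.finrank ℝ (EuclideanSpace ℝ (Fin d)) - 1) • F y)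
      ?_ hI2 ?_
    · rw [this]; simp [show d ≠ 0 by omega]
    · intro y _
      have hpos : 0 < y ^ 2 + ε := by positivity
      have h1 : HasDerivAt (fun y : ℝ => y ^ 2 + ε) (2 * y) y := by
        simpa using (hasDerivAt_pow 2 y).add_const ε
      have h2 := h1.rpow_const (p := -p / 2 - 1) (Or.inl hpos.ne')
      have h3 := ((hasDerivAt_pow d y).const_mul (-p)).mul h2
      refine h3.congr_deriv ?_
      obtain ⟨n, rfl⟩ : ∃ n, d = n + 1 := ⟨d - 1, by omega⟩
      simp only [finrank_euclideanSpace, Fintype.card_fin, smul_eq_mul, F, Nat.add_sub_cancel]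
      rw [show -p / 2 - 1 - 1 = -p / 2 - 2 by ring]
      push_cast
      ring
    · have ht : Tendsto (fun y : ℝ => p * y ^ (-(p + 2 - d))) atTop (nhds 0) := by
        simpa using (tendsto_rpow_neg_atTop (y := p + 2 - d) (by linarith)).const_mul p
      refine squeeze_zero_norm' ?_ ht
      filter_upwards [eventually_gt_atTop (0 : ℝ)] with y hy
      have hpos : 0 < y ^ 2 + ε := by positivity
      rw [norm_mul, norm_mul, norm_neg, Real.norm_of_nonneg hp.le, Real.norm_of_nonneg (by positivity),
        Real.norm_of_nonneg (by positivity), mul_assoc]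
      gcongr
      rw [show -(p + 2 - (d : ℝ)) = d + 2 * (-p / 2 - 1) by ring, Real.rpow_add hy, Real.rpow_mul hy.le,
        Real.rpow_natCast]
      refine mul_le_mul_of_nonneg_left ?_ (by positivity)
      apply Real.rpow_le_rpow_of_nonpos (by positivity)
      · norm_num; exact hε.le
      · linarith
  rw [hz] at hE
  simp only [smul_zero] at hE
  exact hE

theorem auxL_odd {d : ℕ} {p ε : ℝ} (v : EuclideanSpace ℝ (Fin d)) :
    ∫ z, auxL d p ε z * (if ‖z‖ ≤ 1 then ⟪v, z⟫ else 0) = 0 := by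
  have h := integral_neg_eq_self
    (fun z => auxL d p ε z * (if ‖z‖ ≤ 1 then ⟪v, z⟫ else 0)) (volume : Measure (EuclideanSpace ℝ (Fin d)))
  have e : ∀ z, auxL d p ε (-z) * (if ‖-z‖ ≤ 1 then ⟪v, -z⟫ else 0) =
      -(auxL d p ε z * (if ‖z‖ ≤ 1 then ⟪v, z⟫ else 0)) := by
    intro z
    simp only [auxL, norm_neg, inner_neg_right]
    split_ifs <;> ring
  simp_rw [e, integral_neg] at h
  linarith

/-- the remainder term -/
noncomputable def auxR {d : ℕ} (g : EuclideanSpace ℝ (Fin d) → ℝ) (z : EuclideanSpace ℝ (Fin d)) : ℝ :=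
  g z - g 0 - (if ‖z‖ ≤ 1 then ⟪gradient g 0, z⟫ else 0)

theorem auxIte_meas {d : ℕ} (v : EuclideanSpace ℝ (Fin d)) :
    Measurable (fun z : EuclideanSpace ℝ (Fin d) => if ‖z‖ ≤ 1 then ⟪v, z⟫ else (0 : ℝ)) := by
  refine Measurable.ite (measurableSet_le measurable_norm measurable_const) ?_ measurable_const
  exact (by fun_prop : Continuous fun z => ⟪v, z⟫).measurable

theorem aux_identity_eps {d : ℕ} (hd : 1 ≤ d) {p ε : ℝ} (hp : 0 < p) (hpd : (d : ℝ) < p + 2)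
    (hε : 0 < ε) {g : EuclideanSpace ℝ (Fin d) → ℝ}
    (hg : ContDiff ℝ (⊤ : ℕ∞) g) (hc : HasCompactSupport g) :
    ∫ z, auxK d p 0 ε z * ∑ i : Fin d, fderiv ℝ (fun w => fderiv ℝ g w (EuclideanSpace.single i 1)) z
      (EuclideanSpace.single i 1) = ∫ z, auxL d p ε z * auxR g z := by
  rw [aux_ibp2 hε hg hc]
  have hL := auxL_integrable (d := d) hp hpd hε
  have e : ∀ z, auxL d p ε z * auxR g z = auxL d p ε z * g z - auxL d p ε z * g 0
      - auxL d p ε z * (if ‖z‖ ≤ 1 then ⟪gradient g 0, z⟫ else 0) := by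
    intro z; unfold auxR; ring
  simp_rw [e]
  have i1 : Integrable (fun z => auxL d p ε z * g z) :=
    ((auxL_continuous hε).mul hg.continuous).integrable_of_hasCompactSupport hc.mul_left
  have i2 : Integrable (fun z => auxL d p ε z * g 0) := hL.mul_const _
  have i3 : Integrable (fun z => auxL d p ε z * (if ‖z‖ ≤ 1 then ⟪gradient g 0, z⟫ else 0)) := by
    refine hL.mul_bdd (c := ‖gradient g 0‖) (auxIte_meas _).aestronglyMeasurable
      (Eventually.of_forall fun z => ?_)
    split_ifs with h
    · refine (norm_inner_le_norm _ _).trans ?_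
      exact mul_le_of_le_one_right (norm_nonneg _) h
    · simp
  have i12 : Integrable (fun z => auxL d p ε z * g z - auxL d p ε z * g 0) := i1.sub i2
  rw [integral_sub i12 i3, integral_sub i1 i2, auxL_odd, integral_mul_const,
    auxL_integral hd hp hpd hε]
  ring

theorem auxR_bound {d : ℕ} {g : EuclideanSpace ℝ (Fin d) → ℝ}
    (hg : ContDiff ℝ (⊤ : ℕ∞) g) (hc : HasCompactSupport g) :
    ∃ C : ℝ, 0 ≤ C ∧ ∀ z, |auxR g z| ≤ C * ‖z‖ ^ 2 ∧ |auxR g z| ≤ C := by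
  have hg' : ContDiff ℝ 1 (fderiv ℝ g) := hg.fderiv_right (m := 1) (by norm_cast)
  obtain ⟨L, hL⟩ := ContDiff.lipschitzWith_of_hasCompactSupport (hc.fderiv ℝ) hg' one_ne_zero
  obtain ⟨B, hB⟩ := hc.exists_bound_of_continuous hg.continuous
  have hB0 : 0 ≤ B := (norm_nonneg _).trans (hB 0)
  have hLt : ∀ z, ‖z‖ ≤ 1 → |auxR g z| ≤ L * ‖z‖ ^ 2 := by
    intro z hz
    have := (convex_closedBall (0 : EuclideanSpace ℝ (Fin d)) ‖z‖).norm_image_sub_le_of_norm_fderiv_le'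
      (f := g) (φ := fderiv ℝ g 0) (C := L * ‖z‖) (x := 0) (y := z) (𝕜 := ℝ)
      (fun x _ => hg.differentiable (by simp) x) ?_ (by simp) (by simp)
    · rw [sub_zero, Real.norm_eq_abs] at this
      simp only [auxR, hz, if_true, inner_gradient_left]
      nlinarith
    · intro x hx
      have h1 := hL.dist_le_mul x 0
      rw [dist_eq_norm, dist_zero_right] at h1
      refine h1.trans ?_
      gcongr
      simpa using hx
  have hLg : ∀ z, ¬ ‖z‖ ≤ 1 → |auxR g z| ≤ 2 * B := by
    intro z hz
    simp only [auxR, hz, if_false, sub_zero]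
    have h1 := abs_sub (g z) (g 0)
    have h2 := hB z
    have h3 := hB 0
    rw [Real.norm_eq_abs] at h2 h3
    linarith
  refine ⟨L + 2 * B, by positivity, fun z => ?_⟩
  have hL0 : (0 : ℝ) ≤ L := L.2
  by_cases hz : ‖z‖ ≤ 1
  · have h := hLt z hz
    have : ‖z‖ ^ 2 ≤ 1 := by nlinarith [norm_nonneg z]
    constructor <;> nlinarith [norm_nonneg z, sq_nonneg ‖z‖]
  · have h := hLg z hz
    have : 1 ≤ ‖z‖ ^ 2 := by nlinarith [norm_nonneg z]
    constructor <;> nlinarith [norm_nonneg z, sq_nonneg ‖z‖]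

theorem aux_rpow_le {x ε r : ℝ} (hx : 0 < x) (hε : 0 ≤ ε) (hr : 0 ≤ r) :
    (x ^ 2 + ε) ^ (-r / 2) ≤ x ^ (-r) := by
  rw [show -r = ((2 : ℕ) : ℝ) * (-r / 2) by push_cast; ring, Real.rpow_mul hx.le, Real.rpow_natCast,
    show ((2 : ℕ) : ℝ) * (-r / 2) / 2 = -r / 2 by push_cast; ring]
  apply Real.rpow_le_rpow_of_nonpos (by positivity)
  · linarith
  · linarith

theorem aux_rpow_zero {x r : ℝ} (hx : 0 < x) :
    (x ^ 2 + 0) ^ (-r / 2) = x ^ (-r) := by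
  rw [show -r = ((2 : ℕ) : ℝ) * (-r / 2) by push_cast; ring, Real.rpow_mul hx.le, Real.rpow_natCast,
    show ((2 : ℕ) : ℝ) * (-r / 2) / 2 = -r / 2 by push_cast; ring, add_zero]

theorem aux_rpow_tendsto {x r : ℝ} (hx : 0 < x) :
    Tendsto (fun n : ℕ => (x ^ 2 + 1 / ((n : ℝ) + 1)) ^ (-r / 2)) atTop (nhds (x ^ (-r))) := by
  rw [← aux_rpow_zero hx]
  refine Tendsto.rpow_const ?_ (Or.inl (by positivity))
  exact tendsto_const_nhds.add tendsto_one_div_add_atTop_nhds_zero_nat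

theorem aux_rpow_meas {d : ℕ} (p : ℝ) :
    Measurable (fun z : EuclideanSpace ℝ (Fin d) => ‖z‖ ^ (-p)) := by fun_prop

theorem aux_locInt {d : ℕ} (hd : 1 ≤ d) {p : ℝ} (hpd : p < d) :
    LocallyIntegrable (fun z : EuclideanSpace ℝ (Fin d) => ‖z‖ ^ (-p)) := by
  refine locallyIntegrable_of_norm_le_rpow (C := 1) (α := p) (by simpa using hd) (by simpa using hpd)
    (Eventually.of_forall fun z => ?_) (aux_rpow_meas p).aestronglyMeasurable
  rw [Real.norm_of_nonneg (by positivity), one_mul]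

theorem aux_int1 {d : ℕ} (hd : 1 ≤ d) {p : ℝ} (hpd : p < d) {h : EuclideanSpace ℝ (Fin d) → ℝ}
    (hh : Continuous h) (hc : HasCompactSupport h) : Integrable (fun z => ‖z‖ ^ (-p) * h z) := by
  have := (aux_locInt hd hpd).integrable_smul_left_of_hasCompactSupport hh hc
  refine this.congr (Eventually.of_forall fun z => ?_)
  simp [mul_comm]

theorem aux_int2 {d : ℕ} (hd : 1 ≤ d) {p : ℝ} (hp : 0 < p) (hpd : p < d) (hpd2 : (d : ℝ) < p + 2)
    {g : EuclideanSpace ℝ (Fin d) → ℝ}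
    (hg : ContDiff ℝ (⊤ : ℕ∞) g) (hc : HasCompactSupport g) :
    Integrable (fun z => ‖z‖ ^ (-(p + 2)) * auxR g z) := by
  obtain ⟨C, hC0, hC⟩ := auxR_bound hg hc
  have hJ : Integrable (fun z : EuclideanSpace ℝ (Fin d) => ((1 : ℝ) + ‖z‖ ^ 2) ^ (-(p + 2) / 2)) :=
    integrable_rpow_neg_one_add_norm_sq (by simpa using hpd2)
  have hB : Integrable ((Metric.closedBall (0 : EuclideanSpace ℝ (Fin d)) 1).indicator
      (fun z : EuclideanSpace ℝ (Fin d) => ‖z‖ ^ (-p))) :=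
    ((aux_locInt hd hpd).integrableOn_isCompact (isCompact_closedBall _ _)).integrable_indicator
      measurableSet_closedBall
  refine ((hB.const_mul C).add (hJ.const_mul (C * (1 / 2) ^ (-(p + 2) / 2)))).mono' ?_
    (Eventually.of_forall fun z => ?_)
  · refine ((aux_rpow_meas _).mul ?_).aestronglyMeasurable
    unfold auxR
    exact (hg.continuous.measurable.sub measurable_const).sub (auxIte_meas _)
  · simp only [Pi.add_apply]
    rw [norm_mul, Real.norm_of_nonneg (by positivity), Real.norm_eq_abs]
    by_cases hz : ‖z‖ ≤ 1
    · rw [Set.indicator_of_mem (by simpa using hz)]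
      have h2 : 0 ≤ C * (1 / 2) ^ (-(p + 2) / 2) * ((1 : ℝ) + ‖z‖ ^ 2) ^ (-(p + 2) / 2) := by positivity
      have h1 : ‖z‖ ^ (-(p + 2)) * |auxR g z| ≤ C * ‖z‖ ^ (-p) := by
        rcases (norm_nonneg z).eq_or_lt with h0 | h0
        · rw [← h0, Real.zero_rpow (by linarith), Real.zero_rpow (by linarith)]; simp
        · calc ‖z‖ ^ (-(p + 2)) * |auxR g z| ≤ ‖z‖ ^ (-(p + 2)) * (C * ‖z‖ ^ 2) := by
                gcongr; exact (hC z).1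
            _ = C * ‖z‖ ^ (-p) := by
                rw [show -p = -(p + 2) + ((2 : ℕ) : ℝ) by push_cast; ring, Real.rpow_add h0, Real.rpow_natCast]
                ring
      linarith
    · rw [Set.indicator_of_notMem (by simpa using hz), mul_zero, zero_add]
      push Not at hz
      rw [mul_comm, mul_assoc, ← Real.mul_rpow (by norm_num) (by positivity)]
      refine mul_le_mul (hC z).2 ?_ (by positivity) hC0
      rw [← aux_rpow_zero (by linarith)]
      apply Real.rpow_le_rpow_of_nonpos (by positivity)
      · nlinarith
      · linarith

theorem aux_identity {d : ℕ} (hd : 1 ≤ d) {p : ℝ} (hp : 0 < p) (hpd : p < d) (hpd2 : (d : ℝ) < p + 2)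
    {g : EuclideanSpace ℝ (Fin d) → ℝ}
    (hg : ContDiff ℝ (⊤ : ℕ∞) g) (hc : HasCompactSupport g) :
    ∫ z, ‖z‖ ^ (-p) * ∑ i : Fin d, fderiv ℝ (fun w => fderiv ℝ g w (EuclideanSpace.single i 1)) z
      (EuclideanSpace.single i 1) = p * (p + 2 - d) * ∫ z, ‖z‖ ^ (-(p + 2)) * auxR g z := by
  have : Nonempty (Fin d) := ⟨⟨0, hd⟩⟩
  have D : ∀ (φ : EuclideanSpace ℝ (Fin d) → ℝ) (v : EuclideanSpace ℝ (Fin d)),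
    ContDiff ℝ (⊤ : ℕ∞) φ → ContDiff ℝ (⊤ : ℕ∞) (fun w => fderiv ℝ φ w v) := by
    intro φ v h
    exact (h.fderiv_right (m := (⊤ : ℕ∞)) (by simp)).clm_apply contDiff_const
  set lap : EuclideanSpace ℝ (Fin d) → ℝ := fun z =>
    ∑ i : Fin d, fderiv ℝ (fun w => fderiv ℝ g w (EuclideanSpace.single i 1)) z
      (EuclideanSpace.single i 1) with hlap
  have clap : Continuous lap := continuous_finsetSum _ fun i _ => (D _ _ (D _ _ hg)).continuous
  have i1 : Integrable (fun z => ‖z‖ ^ (-p) * lap z) := by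
    simp only [hlap, Finset.mul_sum]
    refine integrable_finsetSum _ fun i _ => aux_int1 hd hpd (D _ _ (D _ _ hg)).continuous
      ((hc.fderiv_apply ℝ _).fderiv_apply ℝ _)
  have i2 := aux_int2 hd hp hpd hpd2 hg hc
  have hne : ∀ᵐ z : EuclideanSpace ℝ (Fin d), z ≠ 0 := by
    simp [ae_iff, measure_singleton]
  have hεn : ∀ n : ℕ, 0 < 1 / ((n : ℝ) + 1) := fun n => by positivity
  have t1 : Tendsto (fun n : ℕ => ∫ z, auxK d p 0 (1 / ((n : ℝ) + 1)) z * lap z) atTop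
      (nhds (∫ z, ‖z‖ ^ (-p) * lap z)) := by
    refine tendsto_integral_of_dominated_convergence _ (fun n => ?_) i1.norm (fun n => ?_) ?_
    · exact ((auxK_contDiff (hεn n)).continuous.mul clap).aestronglyMeasurable
    · filter_upwards [hne] with z hz
      rw [norm_mul, norm_mul]
      gcongr
      rw [auxK, Real.norm_of_nonneg (by positivity), Real.norm_of_nonneg (by positivity), sub_zero]
      exact aux_rpow_le (norm_pos_iff.2 hz) (hεn n).le hp.le
    · filter_upwards [hne] with z hz
      refine Tendsto.mul_const _ ?_
      simp only [auxK, sub_zero]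
      exact aux_rpow_tendsto (norm_pos_iff.2 hz)
  have t2 : Tendsto (fun n : ℕ => ∫ z, auxL d p (1 / ((n : ℝ) + 1)) z * auxR g z) atTop
      (nhds (∫ z, p * (p + 2 - d) * (‖z‖ ^ (-(p + 2)) * auxR g z))) := by
    refine tendsto_integral_of_dominated_convergence _ (fun n => ?_)
      (i2.norm.const_mul (p * d + p * (p + 2))) (fun n => ?_) ?_
    · refine ((auxL_continuous (hεn n)).measurable.mul ?_).aestronglyMeasurable
      unfold auxR
      exact (hg.continuous.measurable.sub measurable_const).sub (auxIte_meas _)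
    · filter_upwards [hne] with z hz
      rw [norm_mul, norm_mul, ← mul_assoc]
      gcongr
      rw [Real.norm_of_nonneg (r := ‖z‖ ^ (-(p + 2))) (by positivity)]
      refine (auxL_bound hp (hεn n) z).trans ?_
      gcongr
      rw [show -p / 2 - 1 = -(p + 2) / 2 by ring]
      exact aux_rpow_le (norm_pos_iff.2 hz) (hεn n).le (by linarith)
    · filter_upwards [hne] with z hz
      have hz' := norm_pos_iff.2 hz
      rw [← mul_assoc]
      refine Tendsto.mul_const _ ?_
      have a := (aux_rpow_tendsto (r := p + 2) hz').const_mul (-p * d)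
      have b := (aux_rpow_tendsto (r := p + 4) hz').const_mul (p * (p + 2) * ‖z‖ ^ 2)
      have c := a.add b
      have e : -p * d * ‖z‖ ^ (-(p + 2)) + p * (p + 2) * ‖z‖ ^ 2 * ‖z‖ ^ (-(p + 4)) =
          p * (p + 2 - d) * ‖z‖ ^ (-(p + 2)) := by
        rw [show -(p + 2) = -(p + 4) + ((2 : ℕ) : ℝ) by push_cast; ring, Real.rpow_add hz', Real.rpow_natCast]
        ring
      rw [e] at c
      refine c.congr fun n => ?_
      simp only [auxL]
      rw [show -(p + 2) / 2 = -p / 2 - 1 by ring, show -(p + 4) / 2 = -p / 2 - 2 by ring]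
  rw [← integral_const_mul]
  refine tendsto_nhds_unique t1 (t2.congr fun n => ?_)
  exact (aux_identity_eps hd hp hpd2 (hεn n) hg hc).symm

theorem aux_prodInt {d : ℕ} (hd : 1 ≤ d) {p : ℝ} (hp : 0 < p) (hpd : p < d)
    {w h : EuclideanSpace ℝ (Fin d) → ℝ} (hw : Integrable w) (hh : Continuous h)
    (hc : HasCompactSupport h) :
    Integrable (fun q : EuclideanSpace ℝ (Fin d) × EuclideanSpace ℝ (Fin d) =>
      w q.1 * ‖q.2 - q.1‖ ^ (-p) * h q.2) (volume.prod volume) := by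
  set k1 := (Metric.closedBall (0 : EuclideanSpace ℝ (Fin d)) 1).indicator
      (fun z : EuclideanSpace ℝ (Fin d) => ‖z‖ ^ (-p)) with hk1
  have hB : Integrable k1 :=
    ((aux_locInt hd hpd).integrableOn_isCompact (isCompact_closedBall _ _)).integrable_indicator
      measurableSet_closedBall
  have c1 := (hw.convolution_integrand (ContinuousLinearMap.mul ℝ ℝ) hB).swap
  obtain ⟨B, hBd⟩ := hc.exists_bound_of_continuous hh
  have c2 := c1.mul_bdd (g := fun q : EuclideanSpace ℝ (Fin d) × EuclideanSpace ℝ (Fin d) => h q.2)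
    (c := B) (hh.comp continuous_snd).aestronglyMeasurable (Eventually.of_forall fun q => hBd q.2)
  have c3 : Integrable (fun q : EuclideanSpace ℝ (Fin d) × EuclideanSpace ℝ (Fin d) =>
      w q.1 * h q.2) (volume.prod volume) := hw.mul_prod (hh.integrable_of_hasCompactSupport hc)
  refine (c2.norm.add c3.norm).mono' ?_ (Eventually.of_forall fun q => ?_)
  · refine (hw.aestronglyMeasurable.comp_fst.mul ?_).mul (hh.comp continuous_snd).aestronglyMeasurable
    exact ((aux_rpow_meas p).comp (measurable_snd.sub measurable_fst)).aestronglyMeasurable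
  · simp only [Pi.add_apply, Function.comp, Prod.fst_swap, Prod.snd_swap, ContinuousLinearMap.mul_apply',
      norm_mul]
    rw [Real.norm_of_nonneg (r := ‖q.2 - q.1‖ ^ (-p)) (by positivity)]
    have hk : ‖q.2 - q.1‖ ^ (-p) ≤ ‖k1 (q.2 - q.1)‖ + 1 := by
      by_cases hz : ‖q.2 - q.1‖ ≤ 1
      · rw [hk1, Set.indicator_of_mem (by simpa using hz), Real.norm_of_nonneg (by positivity)]
        linarith
      · push Not at hz
        have := Real.rpow_le_one_of_one_le_of_nonpos hz.le (by linarith : -p ≤ 0)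
        linarith [norm_nonneg (k1 (q.2 - q.1))]
    calc _ ≤ ‖w q.1‖ * (‖k1 (q.2 - q.1)‖ + 1) * ‖h q.2‖ := by gcongr
      _ = _ := by ring

theorem aux_key {d : ℕ} (hd : 1 ≤ d) {p : ℝ} (hp : 0 < p) (hpd : p < d)
    {u f : EuclideanSpace ℝ (Fin d) → ℝ} (v : EuclideanSpace ℝ (Fin d)) (hu : Integrable u)
    (hu1 : ContDiff ℝ 1 u) (hw : Integrable (fun x => fderiv ℝ u x v))
    (hf : ContDiff ℝ (⊤ : ℕ∞) f) (hc : HasCompactSupport f) :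
    ∫ x, ∫ y, u x * ‖y - x‖ ^ (-p) * fderiv ℝ (fun y' => fderiv ℝ f y' v) y v =
      - ∫ x, ∫ y, fderiv ℝ u x v * ‖y - x‖ ^ (-p) * fderiv ℝ f y v := by
  have D : ∀ (φ : EuclideanSpace ℝ (Fin d) → ℝ) (v : EuclideanSpace ℝ (Fin d)),
    ContDiff ℝ (⊤ : ℕ∞) φ → ContDiff ℝ (⊤ : ℕ∞) (fun w => fderiv ℝ φ w v) := by
    intro φ v h
    exact (h.fderiv_right (m := (⊤ : ℕ∞)) (by simp)).clm_apply contDiff_const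
  have gen : ∀ (w h : EuclideanSpace ℝ (Fin d) → ℝ), Integrable w → Continuous h → HasCompactSupport h →
      ∫ x, ∫ y, w x * ‖y - x‖ ^ (-p) * h y = ∫ z, ‖z‖ ^ (-p) * ∫ x, w x * h (x + z) := by
    intro w h hw hh hc
    have hI := (measurePreserving_prod_add (volume : Measure (EuclideanSpace ℝ (Fin d)))
      (volume : Measure (EuclideanSpace ℝ (Fin d)))).integrable_comp_of_integrable
      (aux_prodInt hd hp hpd hw hh hc)
    have hI' : Integrable (Function.uncurry fun x z => w x * ‖z‖ ^ (-p) * h (x + z))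
        (volume.prod volume) := by
      refine hI.congr (Eventually.of_forall fun q => ?_)
      simp [Function.uncurry]
    have e1 : ∀ x, ∫ y, w x * ‖y - x‖ ^ (-p) * h y = ∫ z, w x * ‖z‖ ^ (-p) * h (x + z) := by
      intro x
      rw [← integral_add_left_eq_self _ x]
      simp
    simp_rw [e1]
    rw [integral_integral_swap hI']
    refine integral_congr_ae (Eventually.of_forall fun z => ?_)
    simp only
    rw [← integral_const_mul]
    refine integral_congr_ae (Eventually.of_forall fun x => ?_)
    simp only
    ring
  rw [gen _ _ hu (D _ _ (D _ _ hf)).continuous ((hc.fderiv_apply ℝ _).fderiv_apply ℝ _),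
    gen _ _ hw (D _ _ hf).continuous (hc.fderiv_apply ℝ _), ← integral_neg]
  refine integral_congr_ae (Eventually.of_forall fun z => ?_)
  simp only
  rw [← mul_neg]
  congr 1
  have hs : ContDiff ℝ (⊤ : ℕ∞) (fun x => fderiv ℝ f (x + z) v) :=
    (D _ v hf).comp (contDiff_id.add contDiff_const)
  have hsc : HasCompactSupport (fun x => fderiv ℝ f (x + z) v) :=
    (hc.fderiv_apply ℝ v).comp_homeomorph (Homeomorph.addRight z)
  have := aux_ibp v hu1 (hs.of_le (by simp)) hsc
  rw [← this]
  refine integral_congr_ae (Eventually.of_forall fun x => ?_)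
  simp only
  rw [fderiv_comp_add_right (f := fun y => fderiv ℝ f y v)]

theorem aux_const {d : ℕ} {α : ℝ} (hα : α ∈ Set.Ioo (0 : ℝ) 2) (hdα : 2 - α < (d : ℝ)) :
    fracCd d α = rieszC d α * ((d + α - 2) * α) := by
  obtain ⟨h0, h2⟩ := hα
  have g1 : Real.Gamma ((d + α) / 2) = (d + α - 2) / 2 * Real.Gamma ((d + α - 2) / 2) := by
    rw [← Real.Gamma_add_one (by linarith)]
    congr 1; ring
  have g2 : Real.Gamma ((2 - α) / 2) = (α / 2) * |Real.Gamma (-α / 2)| := by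
    have h := Real.Gamma_add_one (s := -α / 2) (by linarith)
    have hpos : 0 < Real.Gamma ((2 - α) / 2) := Real.Gamma_pos_of_pos (by linarith)
    rw [show -α / 2 + 1 = (2 - α) / 2 by ring] at h
    have hneg : Real.Gamma (-α / 2) < 0 := by
      by_contra hh
      push Not at hh
      nlinarith
    rw [abs_of_neg hneg, h]; ring
  have g3 : |Real.Gamma (-α / 2)| ≠ 0 := by
    intro h
    rw [h, mul_zero] at g2
    exact (Real.Gamma_pos_of_pos (by linarith : 0 < (2 - α) / 2)).ne' g2
  have g4 : (2 : ℝ) ^ (2 - α) * 2 ^ α = 4 := by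
    rw [← Real.rpow_add (by norm_num)]; norm_num
  have g5 : (2 : ℝ) ^ (2 - α) ≠ 0 := by positivity
  have g6 : Real.pi ^ ((d : ℝ) / 2) ≠ 0 := by positivity
  unfold fracCd rieszC
  rw [g1, g2, show ((d : ℝ) - (2 - α)) / 2 = (d + α - 2) / 2 by ring]
  have hα0 : α ≠ 0 := h0.ne'
  clear g2
  generalize |Real.Gamma (-α / 2)| = G at g3 ⊢
  field_simp
  linear_combination (d + α - 2) * Real.Gamma ((d + α - 2) / 2) * g4

theorem aux_lap {d : ℕ} (hd : 1 ≤ d) {α : ℝ} (hα : α ∈ Set.Ioo (0 : ℝ) 2) (hdα : 2 - α < (d : ℝ))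
    {f : EuclideanSpace ℝ (Fin d) → ℝ}
    (hf : ContDiff ℝ (⊤ : ℕ∞) f) (hc : HasCompactSupport f) (x : EuclideanSpace ℝ (Fin d)) :
    -fracLapD d α f x = rieszC d α * ∑ i : Fin d, ∫ y, ‖y - x‖ ^ (-((d : ℝ) + α - 2)) *
      fderiv ℝ (fun w => fderiv ℝ f w (EuclideanSpace.single i 1)) y (EuclideanSpace.single i 1) := by
  have D : ∀ (φ : EuclideanSpace ℝ (Fin d) → ℝ) (v : EuclideanSpace ℝ (Fin d)),
    ContDiff ℝ (⊤ : ℕ∞) φ → ContDiff ℝ (⊤ : ℕ∞) (fun w => fderiv ℝ φ w v) := by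
    intro φ v h
    exact (h.fderiv_right (m := (⊤ : ℕ∞)) (by simp)).clm_apply contDiff_const
  obtain ⟨h0, h2⟩ := id hα
  have hg : ContDiff ℝ (⊤ : ℕ∞) (fun z => f (x + z)) := hf.comp (contDiff_const.add contDiff_id)
  have hgc : HasCompactSupport (fun z => f (x + z)) := hc.comp_homeomorph (Homeomorph.addLeft x)
  have hpd : (d : ℝ) + α - 2 < d := by linarith
  have key := aux_identity hd (p := d + α - 2) (by linarith) hpd (by linarith) hg hgc
  have grad : gradient (fun z => f (x + z)) 0 = gradient f x := by
    unfold gradient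
    rw [fderiv_comp_add_left, add_zero]
  have eR : ∀ z, ‖z‖ ^ (-((d : ℝ) + α - 2 + 2)) * auxR (fun z => f (x + z)) z =
      (f (x + z) - f x - (if ‖z‖ ≤ 1 then ⟪gradient f x, z⟫ else 0)) * ‖z‖ ^ (-((d : ℝ) + α)) := by
    intro z
    unfold auxR
    simp only [grad, add_zero, sub_add_cancel]
    ring
  simp_rw [eR] at key
  have e2 : ∀ z, ∀ i : Fin d, fderiv ℝ (fun w => fderiv ℝ (fun z => f (x + z)) w (EuclideanSpace.single i 1)) z
      (EuclideanSpace.single i 1) =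
      fderiv ℝ (fun w => fderiv ℝ f w (EuclideanSpace.single i 1)) (x + z) (EuclideanSpace.single i 1) := by
    intro z i
    simp_rw [fderiv_comp_add_left]
    rw [fderiv_comp_add_left (f := fun w => fderiv ℝ f w (EuclideanSpace.single i 1))]
  unfold fracLapD
  rw [neg_neg, aux_const hα hdα, mul_assoc]
  congr 1
  rw [show ((d : ℝ) + α - 2) * α = (d + α - 2) * (d + α - 2 + 2 - d) by ring, ← key]
  simp_rw [Finset.mul_sum]
  rw [integral_finsetSum]
  · refine Finset.sum_congr rfl fun i _ => ?_
    have h3 := integral_add_left_eq_self (μ := volume) (fun y => ‖y - x‖ ^ (-((d : ℝ) + α - 2)) *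
      fderiv ℝ (fun w => fderiv ℝ f w (EuclideanSpace.single i 1)) y (EuclideanSpace.single i 1)) x
    rw [← h3]
    refine integral_congr_ae (Eventually.of_forall fun z => ?_)
    simp only [e2, add_sub_cancel_left]
  · intro i _
    exact aux_int1 hd hpd (D _ _ (D _ _ hg)).continuous ((hgc.fderiv_apply ℝ _).fderiv_apply ℝ _)

theorem aux_inner_grad {d : ℕ} {f g : EuclideanSpace ℝ (Fin d) → ℝ} (x y : EuclideanSpace ℝ (Fin d)) :
    ⟪gradient f x, gradient g y⟫ = ∑ i : Fin d, fderiv ℝ f x (EuclideanSpace.single i 1) *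
      fderiv ℝ g y (EuclideanSpace.single i 1) := by
  rw [PiLp.inner_apply]
  refine Finset.sum_congr rfl fun i _ => ?_
  rw [← inner_gradient_left, ← inner_gradient_left, aux_inner_single, aux_inner_single]
  simp [mul_comm]

theorem stmt_18 (d : ℕ) (hd : 1 ≤ d) (α : ℝ) (hα : α ∈ Set.Ioo (0 : ℝ) 2)
    (hdα : 2 - α < (d : ℝ))
    (V : EuclideanSpace ℝ (Fin d) → ℝ)
    (hV : ContDiff ℝ 1 V)
    (hL1V : Integrable (fun x => Real.exp (-(V x))))
    (hCbV : ∃ M : ℝ, ∀ x, Real.exp (-(V x)) ≤ M)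
    (hL1 : Integrable (fun y => Real.exp (-(V y)) * ‖gradient V y‖))
    (hCb : Continuous (fun y => Real.exp (-(V y)) * ‖gradient V y‖) ∧
      ∃ M : ℝ, ∀ y, Real.exp (-(V y)) * ‖gradient V y‖ ≤ M) :
    ∀ f : EuclideanSpace ℝ (Fin d) → ℝ, ContDiff ℝ (⊤ : ℕ∞) f → HasCompactSupport f →
      ∫ x, (-fracLapD d α f x + ⟪fracDrift d α V x, gradient f x⟫) * Real.exp (-(V x)) = 0 := by
  intro f hf hc
  have D : ∀ (φ : EuclideanSpace ℝ (Fin d) → ℝ) (v : EuclideanSpace ℝ (Fin d)),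
    ContDiff ℝ (⊤ : ℕ∞) φ → ContDiff ℝ (⊤ : ℕ∞) (fun w => fderiv ℝ φ w v) := by
    intro φ v h
    exact (h.fderiv_right (m := (⊤ : ℕ∞)) (by simp)).clm_apply contDiff_const
  obtain ⟨h0, h2⟩ := id hα
  set p : ℝ := (d : ℝ) + α - 2 with hpdef
  have hp : 0 < p := by linarith
  have hpd : p < d := by linarith
  let u : EuclideanSpace ℝ (Fin d) → ℝ := fun x => Real.exp (-(V x))
  have hu1 : ContDiff ℝ 1 u := (hV.neg).exp
  have hgc : Continuous (gradient V) := by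
    unfold gradient
    exact (InnerProductSpace.toDual ℝ (EuclideanSpace ℝ (Fin d))).symm.continuous.comp
      (hV.continuous_fderiv one_ne_zero)
  have hud : ∀ y v, fderiv ℝ u y v = -(u y * fderiv ℝ V y v) := by
    intro y v
    have h1 := ((hV.differentiable one_ne_zero y).hasFDerivAt.neg).exp
    have h2 : fderiv ℝ u y = _ := h1.fderiv
    rw [h2]
    simp [u]
  -- the vector field `u ∇V`
  let W : EuclideanSpace ℝ (Fin d) → EuclideanSpace ℝ (Fin d) := fun y => u y • gradient V y
  have hWc : Continuous W := hu1.continuous.smul hgc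
  have hWn : ∀ y, ‖W y‖ = Real.exp (-(V y)) * ‖gradient V y‖ := by
    intro y
    simp only [W, u, norm_smul, Real.norm_of_nonneg (Real.exp_pos _).le]
  have hWi : Integrable W := by
    refine (integrable_norm_iff hWc.aestronglyMeasurable).1 ?_
    simp_rw [hWn]
    exact hL1
  obtain ⟨M, hM⟩ := hCb.2
  have hw : ∀ v, Integrable (fun x => fderiv ℝ u x v) := by
    intro v
    have := (hWi.inner_const (𝕜 := ℝ) v).neg
    refine this.congr (Eventually.of_forall fun y => ?_)
    simp only [hud, W, Pi.neg_apply, inner_smul_left, inner_gradient_left]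
    simp
  have hker : ∀ x, Integrable (fun y => ‖x - y‖ ^ (-p) • W y) := by
    intro x
    set k1 := (Metric.closedBall (0 : EuclideanSpace ℝ (Fin d)) 1).indicator
      (fun z : EuclideanSpace ℝ (Fin d) => ‖z‖ ^ (-p)) with hk1
    have hB : Integrable k1 :=
      ((aux_locInt hd hpd).integrableOn_isCompact (isCompact_closedBall _ _)).integrable_indicator
        measurableSet_closedBall
    have hB' : Integrable (fun y => k1 (x - y)) := hB.comp_sub_left x
    refine ((hB'.norm.mul_const M).add hWi.norm).mono' ?_ (Eventually.of_forall fun y => ?_)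
    · have hm : AEStronglyMeasurable (fun y => ‖x - y‖ ^ (-p)) volume := ((aux_rpow_meas p).comp (measurable_const.sub measurable_id)).aestronglyMeasurable
      exact hm.smul hWc.aestronglyMeasurable
    · have hMy : ‖W y‖ ≤ M := by rw [hWn]; exact hM y
      have hM0 := (norm_nonneg _).trans hMy
      simp only [Pi.add_apply]
      rw [norm_smul, Real.norm_of_nonneg (by positivity)]
      by_cases hz : ‖x - y‖ ≤ 1
      · rw [hk1, Set.indicator_of_mem (by simpa using hz), Real.norm_of_nonneg (by positivity)]
        have : ‖x - y‖ ^ (-p) * ‖W y‖ ≤ ‖x - y‖ ^ (-p) * M := by gcongr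
        linarith [norm_nonneg (W y)]
      · push Not at hz
        have h1 := Real.rpow_le_one_of_one_le_of_nonpos hz.le (by linarith : -p ≤ 0)
        have h3 : 0 ≤ ‖k1 (x - y)‖ * M := by positivity
        nlinarith [norm_nonneg (W y)]
  -- rewriting the drift term
  have hdrift : ∀ x, ⟪fracDrift d α V x, gradient f x⟫ * u x = rieszC d α * ∑ i : Fin d,
      ∫ y, fderiv ℝ u y (EuclideanSpace.single i 1) * ‖x - y‖ ^ (-p) *
        fderiv ℝ f x (EuclideanSpace.single i 1) := by
    intro x
    have hI : ∀ i : Fin d, Integrable (fun y => fderiv ℝ u y (EuclideanSpace.single i 1) * ‖x - y‖ ^ (-p) *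
        fderiv ℝ f x (EuclideanSpace.single i 1)) := by
      intro i
      refine Integrable.mul_const ?_ _
      have := ((hker x).inner_const (𝕜 := ℝ) (EuclideanSpace.single i 1)).neg
      refine this.congr (Eventually.of_forall fun y => ?_)
      simp only [hud, W, Pi.neg_apply, real_inner_smul_left, inner_gradient_left]
      ring
    rw [← integral_finsetSum _ (fun i _ => hI i)]
    have e1 : ∫ y, (Real.exp (-(V y)) * ‖x - y‖ ^ (-p)) • gradient V y = ∫ y, ‖x - y‖ ^ (-p) • W y := by
      refine integral_congr_ae (Eventually.of_forall fun y => ?_)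
      simp only [W, u, smul_smul, mul_comm]
    have e2 : ⟪∫ y, ‖x - y‖ ^ (-p) • W y, gradient f x⟫ =
        ∫ y, ⟪‖x - y‖ ^ (-p) • W y, gradient f x⟫ := by
      rw [real_inner_comm, ← integral_inner (hker x)]
      simp_rw [real_inner_comm]
    have e3 : ∀ y, ∑ i : Fin d, fderiv ℝ u y (EuclideanSpace.single i 1) * ‖x - y‖ ^ (-p) *
        fderiv ℝ f x (EuclideanSpace.single i 1) = -⟪‖x - y‖ ^ (-p) • W y, gradient f x⟫ := by
      intro y
      simp only [W, real_inner_smul_left, aux_inner_grad, hud, Finset.mul_sum, ← Finset.sum_neg_distrib]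
      refine Finset.sum_congr rfl fun i _ => ?_
      ring
    simp_rw [e3, integral_neg, ← e2]
    unfold fracDrift
    rw [e1, real_inner_smul_left]
    have hexp : Real.exp (V x) * u x = 1 := by
      simp only [u]; rw [← Real.exp_add]; simp
    linear_combination (-(rieszC d α) * ⟪∫ y, ‖x - y‖ ^ (-p) • W y, gradient f x⟫) * hexp
  have hlap : ∀ x, -fracLapD d α f x * u x = rieszC d α * ∑ i : Fin d,
      ∫ y, u x * ‖y - x‖ ^ (-p) *
        fderiv ℝ (fun w => fderiv ℝ f w (EuclideanSpace.single i 1)) y (EuclideanSpace.single i 1) := by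
    intro x
    rw [aux_lap hd hα hdα hf hc, mul_assoc, Finset.sum_mul]
    congr 1
    refine Finset.sum_congr rfl fun i _ => ?_
    simp_rw [mul_assoc]
    rw [integral_const_mul, mul_comm]
  have P1 := fun i : Fin d => aux_prodInt hd hp hpd hL1V
    (D _ (EuclideanSpace.single i 1) (D _ (EuclideanSpace.single i 1) hf)).continuous
    ((hc.fderiv_apply ℝ _).fderiv_apply ℝ _)
  have P2 := fun i : Fin d => aux_prodInt hd hp hpd (hw (EuclideanSpace.single i 1))
    (D _ (EuclideanSpace.single i 1) hf).continuous (hc.fderiv_apply ℝ _)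
  have I1 : ∀ i : Fin d, Integrable (fun x => ∫ y, u x * ‖y - x‖ ^ (-p) *
        fderiv ℝ (fun w => fderiv ℝ f w (EuclideanSpace.single i 1)) y (EuclideanSpace.single i 1)) :=
    fun i => (P1 i).integral_prod_left
  have I2 : ∀ i : Fin d, Integrable (fun x => ∫ y, fderiv ℝ u y (EuclideanSpace.single i 1) *
      ‖x - y‖ ^ (-p) * fderiv ℝ f x (EuclideanSpace.single i 1)) :=
    fun i => (P2 i).integral_prod_right
  have main : ∀ x, (-fracLapD d α f x + ⟪fracDrift d α V x, gradient f x⟫) * Real.exp (-(V x)) =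
      rieszC d α * ∑ i : Fin d, ((∫ y, u x * ‖y - x‖ ^ (-p) *
        fderiv ℝ (fun w => fderiv ℝ f w (EuclideanSpace.single i 1)) y (EuclideanSpace.single i 1)) +
        ∫ y, fderiv ℝ u y (EuclideanSpace.single i 1) * ‖x - y‖ ^ (-p) *
        fderiv ℝ f x (EuclideanSpace.single i 1)) := by
    intro x
    rw [Finset.sum_add_distrib, mul_add, ← hlap, ← hdrift]
    simp only [u]
    ring
  simp_rw [main]
  rw [integral_const_mul, integral_finsetSum]
  swap
  · intro i _
    exact (I1 i).add (I2 i)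
  rw [Finset.sum_eq_zero, mul_zero]
  intro i _
  rw [integral_add (I1 i) (I2 i), aux_key hd hp hpd _ hL1V hu1 (hw _) hf hc,
    ← integral_integral_swap (f := fun y x => fderiv ℝ u y (EuclideanSpace.single i 1) *
      ‖x - y‖ ^ (-p) * fderiv ℝ f x (EuclideanSpace.single i 1)) (P2 i)]
  ring
end
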